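/- arXiv:1711.00769 — 4 statements merged into one kernel-verified Lean document; each statement's English description precedes it below -/
import Mathlib

section
/- For each i ∈ {1,…,n} and every η ∈ W = ker V*, the orthogonal projection of V_i η onto W equals V_i applied to the orthogonal projection of η onto W̃_i; that is, P_W(V_i η) = V_i(P_{W̃_i} η) for all η ∈ ker V*. -/
open ContinuousLinearMap Filter Finset

/-- Product of the commuting operators `V i` over a finite index set `s`. -/
noncomputable def opProd {H : Type*} [NormedAddCommGroup H] [InnerProductSpace ℂ H]
    {n : ℕ} (V : Fin n → H →L[ℂ] H) (hcomm : ∀ i j, Commute (V i) (V j))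
    (s : Finset (Fin n)) : H →L[ℂ] H :=
  s.noncommProd V fun a _ b _ _ => hcomm a b

/-- The wandering subspace `ker ((∏_{i ∈ s} V i)^*)`. -/
noncomputable def wSub {H : Type*} [NormedAddCommGroup H] [InnerProductSpace ℂ H] [CompleteSpace H]
    {n : ℕ} (V : Fin n → H →L[ℂ] H) (hcomm : ∀ i j, Commute (V i) (V j))
    (s : Finset (Fin n)) : Submodule ℂ H :=
  LinearMap.ker (ContinuousLinearMap.adjoint (opProd V hcomm s)).toLinearMap

/-- The orthogonal projection of `H` onto `wSub V hcomm s`, as an operator on `H`. -/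
noncomputable def wProj {H : Type*} [NormedAddCommGroup H] [InnerProductSpace ℂ H] [CompleteSpace H]
    {n : ℕ} (V : Fin n → H →L[ℂ] H) (hcomm : ∀ i j, Commute (V i) (V j))
    (s : Finset (Fin n)) : H →L[ℂ] H :=
  haveI : CompleteSpace (wSub V hcomm s) :=
    (ContinuousLinearMap.isClosed_ker _).completeSpace_coe
  (wSub V hcomm s).subtypeL ∘L Submodule.orthogonalProjectionOnto (wSub V hcomm s)

/-- The operator `U_i = P_W ∘ V_i + Ṽ_i^*`, which restricts to a unitary on `W`. -/
noncomputable def Uop {H : Type*} [NormedAddCommGroup H] [InnerProductSpace ℂ H] [CompleteSpace H]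
    {n : ℕ} (V : Fin n → H →L[ℂ] H) (hcomm : ∀ i j, Commute (V i) (V j))
    (i : Fin n) : H →L[ℂ] H :=
  (wProj V hcomm Finset.univ) ∘L V i
    + ContinuousLinearMap.adjoint (opProd V hcomm (Finset.univ.erase i))

/-- A product of commuting isometries is an isometry. -/
theorem norm_opProd_apply {H : Type*} [NormedAddCommGroup H] [InnerProductSpace ℂ H]
    {n : ℕ} (V : Fin n → H →L[ℂ] H) (hiso : ∀ i x, ‖V i x‖ = ‖x‖)
    (hcomm : ∀ i j, Commute (V i) (V j)) (s : Finset (Fin n)) (x : H) :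
    ‖opProd V hcomm s x‖ = ‖x‖ := by
  refine Finset.noncommProd_induction s V (fun a _ b _ _ => hcomm a b)
    (fun T : H →L[ℂ] H => ∀ x, ‖T x‖ = ‖x‖) ?_ ?_ ?_ x
  · intro S T hS hT x
    rw [mul_apply_eq_comp, hS, hT]
  · intro x
    rw [one_apply_eq_self]
  · exact fun i _ => hiso i

/-- For commuting isometries with product `A` over `s`, the projection onto `ker A^*` is
`1 - A A^*`. -/
theorem wProj_apply {H : Type*} [NormedAddCommGroup H] [InnerProductSpace ℂ H] [CompleteSpace H]
    {n : ℕ} (V : Fin n → H →L[ℂ] H) (hiso : ∀ i x, ‖V i x‖ = ‖x‖)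
    (hcomm : ∀ i j, Commute (V i) (V j)) (s : Finset (Fin n)) (x : H) :
    wProj V hcomm s x
      = x - opProd V hcomm s (ContinuousLinearMap.adjoint (opProd V hcomm s) x) := by
  have hA := (opProd V hcomm s).norm_map_iff_adjoint_comp_self.mp
    (norm_opProd_apply V hiso hcomm s)
  have : CompleteSpace (wSub V hcomm s) :=
    (ContinuousLinearMap.isClosed_ker _).completeSpace_coe
  refine Submodule.eq_starProjection_of_mem_of_inner_eq_zero (K := wSub V hcomm s) ?_ ?_
  · have h := DFunLike.congr_fun hA (ContinuousLinearMap.adjoint (opProd V hcomm s) x)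
    simp only [ContinuousLinearMap.comp_apply, one_apply_eq_self] at h
    simp [wSub, h]
  · intro w hw
    have hw' : ContinuousLinearMap.adjoint (opProd V hcomm s) w = 0 := hw
    rw [sub_sub_cancel, ← ContinuousLinearMap.adjoint_inner_right, hw', inner_zero_right]

/-- For each `i` and every `η ∈ W = ker V^*`, one has `P_W (V_i η) = V_i (P_{W̃_i} η)`. -/
theorem stmt0 {H : Type*} [NormedAddCommGroup H] [InnerProductSpace ℂ H] [CompleteSpace H]
    {n : ℕ} (hn : 2 ≤ n) (V : Fin n → H →L[ℂ] H)
    (hiso : ∀ i x, ‖V i x‖ = ‖x‖) (hcomm : ∀ i j, Commute (V i) (V j))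
    (hshift : ∀ x : H,
      Tendsto (fun m : ℕ => ((ContinuousLinearMap.adjoint (opProd V hcomm Finset.univ)) ^ m) x)
        atTop (nhds 0))
    (i : Fin n) (η : H) (hη : η ∈ wSub V hcomm Finset.univ) :
    wProj V hcomm Finset.univ (V i η) = V i (wProj V hcomm (Finset.univ.erase i) η) := by
  have hl : opProd V hcomm univ = V i * opProd V hcomm (univ.erase i) :=
    (Finset.mul_noncommProd_erase _ (mem_univ i) V _).symm
  have hadj : ContinuousLinearMap.adjoint (opProd V hcomm univ) (V i η)
      = ContinuousLinearMap.adjoint (opProd V hcomm (univ.erase i)) η := by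
    refine ext_inner_right ℂ fun y => ?_
    rw [ContinuousLinearMap.adjoint_inner_left, ContinuousLinearMap.adjoint_inner_left, hl,
      mul_apply_eq_comp]
    exact (LinearMap.norm_map_iff_inner_map_map (V i)).mp (hiso i) _ _
  rw [wProj_apply V hiso, wProj_apply V hiso, hadj, hl, map_sub, mul_apply_eq_comp]
end

section
/- For all p, q ∈ {1,…,n} with p ≠ q and every η ∈ W = ker V*, one has U_p(U_q η) = U_q(U_p η); that is, the unitary operators U_1, …, U_n on W commute pairwise. -/
open ContinuousLinearMap Filter Finset

/-- In a star ring, the elements `a + (1 - abr)(br)^*` and `b + (1 - abr)(ar)^*` commute for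
commuting isometries `a`, `b`, `r`. -/
theorem add_one_sub_mul_star_comm {R : Type*} [Ring R] [StarRing R] {a b r : R}
    (hab : a * b = b * a) (har : a * r = r * a) (hbr : b * r = r * b)
    (ha : star a * a = 1) (hb : star b * b = 1) (hr : star r * r = 1) :
    (a + (1 - a * (b * r)) * star (b * r)) * (b + (1 - a * (b * r)) * star (a * r)) =
      (b + (1 - a * (b * r)) * star (a * r)) * (a + (1 - a * (b * r)) * star (b * r)) := by
  have isom_mul {x y : R} (hx : star x * x = 1) (hy : star y * y = 1) :
      star (x * y) * (x * y) = 1 := by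
    rw [star_mul, mul_assoc, ← mul_assoc (star x), hx, one_mul, hy]
  have expand {x y t u v : R} (h₁ : star t * y = star r) (h₂ : star t * v = x)
      (h₃ : x * v = v * x) :
      (x + (1 - v) * star t) * (y + (1 - v) * star u) =
        x * y + (1 - v) * star r + (1 - v) * (star t * star u) := by
    have : (x + (1 - v) * star t) * (y + (1 - v) * star u) =
        x * y + (1 - v) * (star t * y) + (1 - v) * (star t * star u)
          + (x * (1 - v) - (1 - v) * (star t * v)) * star u := by noncomm_ring
    rw [this, h₁, h₂, mul_sub, sub_mul, h₃]
    simp [sub_mul]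
  have hav : a * (a * (b * r)) = a * (b * r) * a := by
    rw [mul_assoc, mul_assoc, ← har, ← mul_assoc b, ← hab, mul_assoc a b r]
  have hbv : b * (a * (b * r)) = a * (b * r) * b := by
    rw [mul_assoc, mul_assoc, ← hbr, ← mul_assoc b, ← hab, mul_assoc]
  have hva : a * (b * r) = b * r * a := by rw [mul_assoc, ← har, ← mul_assoc, hab, mul_assoc]
  have hvb : a * (b * r) = a * r * b := by rw [mul_assoc, hbr]
  have hstar {x : R} (hx : star x * x = 1) : star (x * r) * x = star r := by
    rw [star_mul, mul_assoc, hx, mul_one]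
  have hTa : star (b * r) * (a * (b * r)) = a := by
    rw [hva, ← mul_assoc, isom_mul hb hr, one_mul]
  have hTb : star (a * r) * (a * (b * r)) = b := by
    rw [hvb, ← mul_assoc, isom_mul ha hr, one_mul]
  rw [expand (hstar hb) hTa hav, expand (hstar ha) hTb hbv, hab, ← star_mul, ← star_mul]
  congr 3
  rw [mul_assoc, mul_assoc, ← mul_assoc r b, ← hbr, ← mul_assoc r a, ← har, mul_assoc b r,
    mul_assoc a r, ← mul_assoc a b, ← mul_assoc b a, hab]

section

variable {H : Type*} [NormedAddCommGroup H] [InnerProductSpace ℂ H] {n : ℕ}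
  (V : Fin n → H →L[ℂ] H) (hcomm : ∀ i j, Commute (V i) (V j))

theorem mul_opProd_erase {s : Finset (Fin n)} {i : Fin n} (hi : i ∈ s) :
    V i * opProd V hcomm (s.erase i) = opProd V hcomm s :=
  Finset.mul_noncommProd_erase s hi V _

theorem commute_opProd (i : Fin n) (s : Finset (Fin n)) : Commute (V i) (opProd V hcomm s) :=
  Finset.noncommProd_commute s V _ _ fun _ _ => hcomm _ _

variable [CompleteSpace H]

theorem star_opProd_mul_self (hiso : ∀ i x, ‖V i x‖ = ‖x‖) (s : Finset (Fin n)) :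
    star (opProd V hcomm s) * opProd V hcomm s = 1 := by
  refine (ContinuousLinearMap.norm_map_iff_adjoint_comp_self _).1 ?_
  refine Finset.noncommProd_induction s V _ (fun T : H →L[ℂ] H => ∀ x, ‖T x‖ = ‖x‖) ?_ ?_ ?_
  · intro S T hS hT x
    exact (hS _).trans (hT x)
  · exact fun _ => rfl
  · exact fun i _ => hiso i

theorem wProj_eq (hiso : ∀ i x, ‖V i x‖ = ‖x‖) (s : Finset (Fin n)) :
    wProj V hcomm s = 1 - opProd V hcomm s * star (opProd V hcomm s) := by
  ext x
  have : CompleteSpace (wSub V hcomm s) :=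
    (ContinuousLinearMap.isClosed_ker _).completeSpace_coe
  refine Submodule.eq_starProjection_of_mem_of_inner_eq_zero (K := wSub V hcomm s) ?_ ?_
  · have h : star (opProd V hcomm s) * (1 - opProd V hcomm s * star (opProd V hcomm s)) = 0 := by
      rw [mul_sub, ← mul_assoc, star_opProd_mul_self V hcomm hiso, mul_one, one_mul, sub_self]
    exact DFunLike.congr_fun h x
  · intro w hw
    have hw' : ContinuousLinearMap.adjoint (opProd V hcomm s) w = 0 := hw
    have h : x - (1 - opProd V hcomm s * star (opProd V hcomm s)) x =
        opProd V hcomm s (star (opProd V hcomm s) x) := by simp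
    rw [h, ← ContinuousLinearMap.adjoint_inner_right, hw', inner_zero_right]

theorem Uop_eq (hiso : ∀ i x, ‖V i x‖ = ‖x‖) (i : Fin n) :
    Uop V hcomm i =
      V i + (1 - opProd V hcomm univ) * star (opProd V hcomm (univ.erase i)) := by
  have hi : star (V i) * V i = 1 :=
    (ContinuousLinearMap.norm_map_iff_adjoint_comp_self _).1 (hiso i)
  have h : star (opProd V hcomm univ) * V i = star (opProd V hcomm (univ.erase i)) := by
    rw [← mul_opProd_erase V hcomm (mem_univ i), star_mul, mul_assoc, hi, mul_one]
  change wProj V hcomm univ * V i + star (opProd V hcomm (univ.erase i)) = _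
  rw [wProj_eq V hcomm hiso, sub_mul, mul_assoc, h]
  noncomm_ring

end

/-- The unitaries `U_1, …, U_n` commute pairwise on `W = ker V^*`. -/
theorem stmt4 {H : Type*} [NormedAddCommGroup H] [InnerProductSpace ℂ H] [CompleteSpace H]
    {n : ℕ} (hn : 2 ≤ n) (V : Fin n → H →L[ℂ] H)
    (hiso : ∀ i x, ‖V i x‖ = ‖x‖) (hcomm : ∀ i j, Commute (V i) (V j))
    (hshift : ∀ x : H,
      Tendsto (fun m : ℕ => ((ContinuousLinearMap.adjoint (opProd V hcomm Finset.univ)) ^ m) x)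
        atTop (nhds 0))
    (p q : Fin n) (hpq : p ≠ q) (η : H) (hη : η ∈ wSub V hcomm Finset.univ) :
    Uop V hcomm p (Uop V hcomm q η) = Uop V hcomm q (Uop V hcomm p η) := by
  have hV := mul_opProd_erase V hcomm (mem_univ p)
  have hp := mul_opProd_erase V hcomm (mem_erase.2 ⟨hpq.symm, mem_univ q⟩)
  have hq := mul_opProd_erase V hcomm (mem_erase.2 ⟨hpq, mem_univ p⟩)
  rw [Finset.erase_right_comm] at hq
  have isom (i : Fin n) : star (V i) * V i = 1 :=
    (ContinuousLinearMap.norm_map_iff_adjoint_comp_self _).1 (hiso i)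
  have key := add_one_sub_mul_star_comm (hcomm p q).eq
    (commute_opProd V hcomm p ((univ.erase p).erase q)).eq
    (commute_opProd V hcomm q ((univ.erase p).erase q)).eq
    (isom p) (isom q) (star_opProd_mul_self V hcomm hiso _)
  rw [hp, hq, hV, ← Uop_eq V hcomm hiso, ← Uop_eq V hcomm hiso] at key
  exact DFunLike.congr_fun key η
end

section
/- If S is an invariant subspace of finite codimension in H²(𝔻ⁿ), then every compact operator on S belongs to T(S); that is, K(S) ⊆ T(S). -/
open ContinuousLinearMap

/-- The `C^*`-algebra generated by a set `R` of operators on a Hilbert space `E`: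
the operator-norm closure of the star subalgebra generated by `R`. -/
noncomputable def genCStar {E : Type*} [NormedAddCommGroup E] [InnerProductSpace ℂ E]
    [CompleteSpace E] (R : Set (E →L[ℂ] E)) : Set (E →L[ℂ] E) :=
  ((StarAlgebra.adjoin ℂ R).topologicalClosure : Set (E →L[ℂ] E))

/-- The Hardy space `H²(𝔻ⁿ)` realized as `ℓ²` over multi-indices `Fin n → ℕ`. -/
abbrev PolyHardy (n : ℕ) : Type := lp (fun _ : Fin n → ℕ => ℂ) 2

/-- The compression `P_S T|_S` of an operator `T` on `H²(𝔻ⁿ)` to a closed subspace `S`. -/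
noncomputable def compressS {n : ℕ} (S : Submodule ℂ (PolyHardy n))
    (hS : IsClosed (S : Set (PolyHardy n))) (T : PolyHardy n →L[ℂ] PolyHardy n) :
    ↥S →L[ℂ] ↥S :=
  haveI : CompleteSpace ↥S := hS.completeSpace_coe
  Submodule.orthogonalProjectionOnto S ∘L (T ∘L S.subtypeL)

/-- The restriction `T|_S : S → S` of an operator `T` leaving `S` invariant. -/
noncomputable def restrictS {n : ℕ} (S : Submodule ℂ (PolyHardy n))
    (T : PolyHardy n →L[ℂ] PolyHardy n) (h : ∀ x ∈ S, T x ∈ S) : ↥S →L[ℂ] ↥S :=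
  ContinuousLinearMap.codRestrict (T ∘L S.subtypeL) S fun x => h x x.2

/-- The orthogonal projection of `H²(𝔻ⁿ)` onto a closed subspace `S`, as an operator on
`H²(𝔻ⁿ)`. -/
noncomputable def projFull {n : ℕ} (S : Submodule ℂ (PolyHardy n))
    (hS : IsClosed (S : Set (PolyHardy n))) : PolyHardy n →L[ℂ] PolyHardy n :=
  haveI : CompleteSpace ↥S := hS.completeSpace_coe
  S.subtypeL ∘L Submodule.orthogonalProjectionOnto S

/-- The adjoint of an operator on a closed subspace `S` of `H²(𝔻ⁿ)`. -/
noncomputable def adjS {n : ℕ} (S : Submodule ℂ (PolyHardy n))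
    (hS : IsClosed (S : Set (PolyHardy n))) (T : ↥S →L[ℂ] ↥S) : ↥S →L[ℂ] ↥S :=
  haveI : CompleteSpace ↥S := hS.completeSpace_coe
  ContinuousLinearMap.adjoint T

/-- The `C^*`-algebra `T(S) ⊆ B(S)` generated by operators `R i` on a closed subspace `S`. -/
noncomputable def TalgGen {n : ℕ} (S : Submodule ℂ (PolyHardy n))
    (hS : IsClosed (S : Set (PolyHardy n))) (R : Fin n → (↥S →L[ℂ] ↥S)) :
    Set (↥S →L[ℂ] ↥S) :=
  haveI : CompleteSpace ↥S := hS.completeSpace_coe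
  genCStar (Set.range R)

/-- The `C^*`-algebra `T(H²(𝔻ⁿ))` generated by the coordinate shifts. -/
noncomputable def TalgFull {n : ℕ} (Mz : Fin n → (PolyHardy n →L[ℂ] PolyHardy n)) :
    Set (PolyHardy n →L[ℂ] PolyHardy n) :=
  genCStar (Set.range Mz)

open scoped InnerProductSpace ENNReal

section CompactMem

variable {E : Type*} [NormedAddCommGroup E] [InnerProductSpace ℂ E]

/-- A compact operator is within any `ε > 0` of its composition with the projection onto some
finite-dimensional subspace. -/
theorem exists_norm_sub_starProjection_comp_le {T : E →L[ℂ] E} (hT : IsCompactOperator T) {ε : ℝ}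
    (hε : 0 < ε) : ∃ (U : Submodule ℂ E) (_ : FiniteDimensional ℂ U),
      ‖T - U.starProjection ∘L T‖ ≤ ε := by
  have hc : IsCompact (closure (T '' Metric.closedBall 0 1)) :=
    IsCompactOperator.isCompact_closure_image_closedBall (f := T.toLinearMap) hT 1
  obtain ⟨t, ht, hcov⟩ := Metric.totallyBounded_iff.mp hc.totallyBounded ε hε
  have : FiniteDimensional ℂ (Submodule.span ℂ t) := FiniteDimensional.span_of_finite ℂ ht
  refine ⟨Submodule.span ℂ t, inferInstance, ?_⟩
  refine ContinuousLinearMap.opNorm_le_of_unit_norm hε.le fun x hx => ?_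
  have hx' : T x ∈ closure (T '' Metric.closedBall 0 1) :=
    subset_closure ⟨x, by simp [hx], rfl⟩
  obtain ⟨u, hu, hd⟩ := Set.mem_iUnion₂.mp (hcov hx')
  have hmin := (Submodule.span ℂ t).starProjection_minimal (T x)
  calc ‖T x - (Submodule.span ℂ t).starProjection (T x)‖
      ≤ ‖T x - u‖ := by
        rw [hmin]
        exact ciInf_le ⟨0, by rintro _ ⟨_, rfl⟩; exact norm_nonneg _⟩
          (⟨u, Submodule.subset_span hu⟩ : Submodule.span ℂ t)
    _ ≤ ε := by rw [← dist_eq_norm]; exact (Metric.mem_ball.mp hd).le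

variable [CompleteSpace E]

/-- If every nonzero vector is cyclic for `A`, the orbit of a nonzero vector is dense. -/
theorem mem_closure_orbit {A : StarSubalgebra ℂ (E →L[ℂ] E)}
    (hirr : ∀ x y : E, x ≠ 0 → (∀ a ∈ A, ⟪a x, y⟫_ℂ = 0) → y = 0) {x : E} (hx : x ≠ 0) (y : E) :
    y ∈ closure ((fun a : E →L[ℂ] E => a x) '' (A : Set (E →L[ℂ] E))) := by
  set W : Submodule ℂ E := (Subalgebra.toSubmodule A.toSubalgebra).map
    (ContinuousLinearMap.apply ℂ E x).toLinearMap with hW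
  have h1 : Wᗮ = ⊥ := by
    rw [eq_bot_iff]
    intro z hz
    rw [Submodule.mem_bot]
    refine hirr x z hx fun a ha => ?_
    rw [Submodule.mem_orthogonal] at hz
    exact hz _ ⟨a, ha, rfl⟩
  have h2 : W.topologicalClosure = ⊤ := Submodule.topologicalClosure_eq_top_iff.mpr h1
  have h3 : y ∈ W.topologicalClosure := by rw [h2]; trivial
  exact h3

/-- An irreducible star algebra containing a nonzero finite-rank operator contains a nonzero
rank-one operator. -/
theorem exists_rankOne_mem {A : StarSubalgebra ℂ (E →L[ℂ] E)}
    (hirr : ∀ x y : E, x ≠ 0 → (∀ a ∈ A, ⟪a x, y⟫_ℂ = 0) → y = 0)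
    (hF : ∃ F ∈ A, F ≠ 0 ∧ FiniteDimensional ℂ F.range) :
    ∃ v w : E, v ≠ 0 ∧ w ≠ 0 ∧ InnerProductSpace.rankOne ℂ v w ∈ A := by
  classical
  have hex : ∃ r : ℕ, ∃ F ∈ A, F ≠ 0 ∧ FiniteDimensional ℂ F.range ∧
      Module.finrank ℂ F.range = r := by
    obtain ⟨F, h1, h2, h3⟩ := hF
    exact ⟨_, F, h1, h2, h3, rfl⟩
  obtain ⟨F, hFA, hF0, hFfd, hFr⟩ := Nat.find_spec hex
  have hmin : ∀ G ∈ A, G.range < F.range → G = 0 := by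
    intro G hG hlt
    by_contra hG0
    have hfd : FiniteDimensional ℂ G.range := Submodule.finiteDimensional_of_le hlt.le
    refine Nat.find_min hex ?_ ⟨G, hG, hG0, hfd, rfl⟩
    rw [← hFr]
    exact Submodule.finrank_lt_finrank_of_lt hlt
  obtain ⟨x, hx⟩ : ∃ x, F x ≠ 0 := by
    by_contra! h
    exact hF0 (ContinuousLinearMap.ext h)
  have hmem : ∀ u, F u ∈ F.range := fun u => ⟨u, rfl⟩
  have : Nontrivial F.range :=
    ⟨⟨⟨F x, hmem x⟩, 0, fun h => hx (congrArg Subtype.val h)⟩⟩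
  have hscal : ∀ a ∈ A, ∃ c : ℂ, ∀ u, F (a (F u)) = c • F u := by
    intro a ha
    let φ : Module.End ℂ F.range :=
      ((F * a).toLinearMap).restrict (p := F.range) (q := F.range) (fun u _ => hmem (a u))
    obtain ⟨c, hc⟩ := Module.End.exists_eigenvalue φ
    obtain ⟨u, hu⟩ := hc.exists_hasEigenvector
    refine ⟨c, ?_⟩
    have hG : F * a * F - c • F ∈ A := sub_mem (mul_mem (mul_mem hFA ha) hFA) (A.smul_mem hFA c)
    have hle : (F * a * F - c • F).range ≤ F.range := by
      rintro _ ⟨z, rfl⟩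
      exact sub_mem (hmem (a (F z))) (Submodule.smul_mem _ _ (hmem z))
    have hne : (F * a * F - c • F).range ≠ F.range := by
      intro heq
      have hsurj : Function.Surjective (φ - algebraMap ℂ (Module.End ℂ F.range) c) := by
        rintro ⟨z, hz⟩
        have hz' := hz
        rw [← heq] at hz'
        obtain ⟨w, hw⟩ := hz'
        exact ⟨⟨F w, hmem w⟩, Subtype.ext hw⟩
      have hinj := LinearMap.injective_iff_surjective.mpr hsurj
      refine hu.2 (hinj ?_)
      rw [map_zero, LinearMap.sub_apply, hu.apply_eq_smul]
      simp
    have h0 := hmin _ hG (lt_of_le_of_ne hle hne)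
    intro u
    have := congrArg (fun T : E →L[ℂ] E => T u) h0
    simpa [sub_eq_zero] using this
  have hspan : ∀ u, F u ∈ (ℂ ∙ (F x)) := by
    intro u
    have hcl : IsClosed ((ℂ ∙ (F x) : Submodule ℂ E) : Set E) :=
      Submodule.closed_of_finiteDimensional _
    have h1 : closure ((fun a : E →L[ℂ] E => a (F x)) '' (A : Set (E →L[ℂ] E))) ⊆
        F ⁻¹' ((ℂ ∙ (F x) : Submodule ℂ E) : Set E) := by
      refine closure_minimal ?_ (hcl.preimage F.continuous)
      rintro _ ⟨a, ha, rfl⟩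
      obtain ⟨c, hc⟩ := hscal a ha
      change F (a (F x)) ∈ (ℂ ∙ (F x) : Submodule ℂ E)
      rw [hc x]
      exact Submodule.smul_mem _ _ (Submodule.mem_span_singleton_self _)
    exact h1 (mem_closure_orbit hirr hx u)
  have heq : F = InnerProductSpace.rankOne ℂ (F x)
      (((‖F x‖ ^ 2 : ℝ) : ℂ)⁻¹ • adjoint F (F x)) := by
    ext u
    obtain ⟨c, hc⟩ := Submodule.mem_span_singleton.mp (hspan u)
    have hn : ((‖F x‖ : ℝ) : ℂ) ≠ 0 := by exact_mod_cast norm_ne_zero_iff.mpr hx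
    rw [InnerProductSpace.rankOne_apply, inner_smul_left, adjoint_inner_left, ← hc,
      inner_smul_right, inner_self_eq_norm_sq_to_K]
    congr 1
    simp
    field_simp
  refine ⟨F x, _, hx, ?_, heq ▸ hFA⟩
  intro h0
  rw [h0, map_zero] at heq
  exact hF0 heq

/-- A closed irreducible star algebra of operators containing a nonzero finite-rank operator
contains every compact operator. -/
theorem isCompactOperator_mem_of_irreducible {A : StarSubalgebra ℂ (E →L[ℂ] E)}
    (hA : IsClosed (A : Set (E →L[ℂ] E)))
    (hirr : ∀ x y : E, x ≠ 0 → (∀ a ∈ A, ⟪a x, y⟫_ℂ = 0) → y = 0)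
    (hF : ∃ F ∈ A, F ≠ 0 ∧ FiniteDimensional ℂ F.range)
    {T : E →L[ℂ] E} (hT : IsCompactOperator T) : T ∈ A := by
  obtain ⟨v, w, hv, hw, hvw⟩ := exists_rankOne_mem hirr hF
  have hleft : ∀ s, InnerProductSpace.rankOne ℂ s w ∈ A := by
    intro s
    have h1 : closure ((fun a : E →L[ℂ] E => a v) '' (A : Set (E →L[ℂ] E))) ⊆
        (fun s => InnerProductSpace.rankOne ℂ s w) ⁻¹' (A : Set (E →L[ℂ] E)) := by
      refine closure_minimal ?_ (hA.preimage (by fun_prop))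
      rintro _ ⟨a, ha, rfl⟩
      change InnerProductSpace.rankOne ℂ (a v) w ∈ A
      rw [← InnerProductSpace.comp_rankOne]
      exact mul_mem ha hvw
    exact h1 (mem_closure_orbit hirr hv s)
  have hall : ∀ s t, InnerProductSpace.rankOne ℂ s t ∈ A := by
    intro s t
    have h1 : closure ((fun a : E →L[ℂ] E => a w) '' (A : Set (E →L[ℂ] E))) ⊆
        (fun t => InnerProductSpace.rankOne ℂ s t) ⁻¹' (A : Set (E →L[ℂ] E)) := by
      refine closure_minimal ?_ (hA.preimage (by fun_prop))
      rintro _ ⟨a, ha, rfl⟩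
      change InnerProductSpace.rankOne ℂ s (a w) ∈ A
      have h2 : InnerProductSpace.rankOne ℂ s (a w) =
          InnerProductSpace.rankOne ℂ s w ∘L adjoint a := by
        rw [InnerProductSpace.rankOne_comp, adjoint_adjoint]
      rw [h2]
      exact mul_mem (hleft s) (star_mem ha)
    exact h1 (mem_closure_orbit hirr hw t)
  have : T ∈ closure (A : Set (E →L[ℂ] E)) := by
    rw [Metric.mem_closure_iff]
    intro ε hε
    obtain ⟨U, hU, hle⟩ := exists_norm_sub_starProjection_comp_le hT (half_pos hε)
    refine ⟨U.starProjection ∘L T, ?_, ?_⟩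
    · rw [(stdOrthonormalBasis ℂ U).starProjection_eq_sum_rankOne,
        ContinuousLinearMap.finsetSum_comp]
      refine sum_mem fun i _ => ?_
      rw [InnerProductSpace.rankOne_comp]
      exact hall _ _
    · rw [dist_eq_norm]
      linarith
  rwa [hA.closure_eq] at this

/-- The set `genCStar R` is the carrier of a closed star subalgebra containing `R`. -/
theorem exists_starSubalgebra_coe_eq_genCStar (R : Set (E →L[ℂ] E)) :
    ∃ A : StarSubalgebra ℂ (E →L[ℂ] E),
      (A : Set (E →L[ℂ] E)) = genCStar R ∧ IsClosed (A : Set (E →L[ℂ] E)) ∧ ∀ T ∈ R, T ∈ A :=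
  ⟨_, rfl, StarSubalgebra.isClosed_topologicalClosure _, fun _ hT =>
    StarSubalgebra.le_topologicalClosure _ (StarAlgebra.subset_adjoin ℂ R hT)⟩

end CompactMem

/-- The isometry `ℓ²(α) → ℓ²(β)` sending the basis vector at `a` to the one at `σ a`. -/
noncomputable def lpMapDomain {α β : Type*} (σ : α ↪ β) :
    lp (fun _ : α => ℂ) 2 →ₗᵢ[ℂ] lp (fun _ : β => ℂ) 2 :=
  have hsum (f : lp (fun _ : α => ℂ) 2) :
      HasSum (fun b => ‖Function.extend σ f 0 b‖ ^ (2 : ℝ≥0∞).toReal)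
        (‖f‖ ^ (2 : ℝ≥0∞).toReal) := by
    refine (σ.injective.hasSum_iff fun b hb => ?_).mp ?_
    · rw [Function.extend_apply' _ _ _ hb]
      simp
    · convert lp.hasSum_norm (by norm_num) f using 2 with a
      simp [σ.injective.extend_apply]
  { toFun f := ⟨Function.extend σ f 0, memℓp_gen (hsum f).summable⟩
    map_add' f g := by
      ext b
      change Function.extend σ (f + g) 0 b = Function.extend σ f 0 b + Function.extend σ g 0 b
      by_cases hb : ∃ a, σ a = b
      · obtain ⟨a, rfl⟩ := hb
        simp only [σ.injective.extend_apply]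
        rfl
      · simp only [Function.extend_apply' _ _ _ hb]
        simp
    map_smul' c f := by
      ext b
      change Function.extend σ (c • f) 0 b = c • Function.extend σ f 0 b
      by_cases hb : ∃ a, σ a = b
      · obtain ⟨a, rfl⟩ := hb
        simp only [σ.injective.extend_apply]
        rfl
      · simp only [Function.extend_apply' _ _ _ hb]
        simp
    norm_map' f := by
      refine (Real.rpow_left_inj (norm_nonneg _) (norm_nonneg _)
        (z := (2 : ℝ≥0∞).toReal) (by norm_num)).mp ?_
      exact (lp.hasSum_norm (by norm_num) _).unique (hsum f) }

theorem lpMapDomain_apply {α β : Type*} (σ : α ↪ β) (f : lp (fun _ : α => ℂ) 2) (a : α) :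
    lpMapDomain σ f (σ a) = f a :=
  σ.injective.extend_apply _ _ _

theorem lpMapDomain_apply_of_notMem {α β : Type*} (σ : α ↪ β) (f : lp (fun _ : α => ℂ) 2) (b : β)
    (hb : b ∉ Set.range σ) : lpMapDomain σ f b = 0 :=
  Function.extend_apply' _ _ _ hb

theorem lpMapDomain_single {α β : Type*} [DecidableEq α] [DecidableEq β] (σ : α ↪ β) (a : α)
    (c : ℂ) : lpMapDomain σ (lp.single 2 a c) = lp.single 2 (σ a) c := by
  ext b
  by_cases hb : b ∈ Set.range σ
  · obtain ⟨a', rfl⟩ := hb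
    rw [lpMapDomain_apply]
    simp [lp.single_apply, Pi.single_apply]
  · rw [lpMapDomain_apply_of_notMem _ _ _ hb, lp.single_apply_ne]
    rintro rfl
    exact hb ⟨a, rfl⟩

theorem lp_apply_eq_inner {α : Type*} [DecidableEq α] (f : lp (fun _ : α => ℂ) 2) (a : α) :
    f a = ⟪(lp.single 2 a (1 : ℂ) : lp (fun _ : α => ℂ) 2), f⟫_ℂ := by
  rw [lp.inner_single_left]; simp

theorem lpMapDomain_comp {α β γ : Type*} (σ : α ↪ β) (ρ : β ↪ γ) (f : lp (fun _ : α => ℂ) 2) :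
    lpMapDomain ρ (lpMapDomain σ f) = lpMapDomain (σ.trans ρ) f := by
  ext c
  by_cases hc : c ∈ Set.range ρ
  · obtain ⟨b, rfl⟩ := hc
    rw [lpMapDomain_apply]
    by_cases hb : b ∈ Set.range σ
    · obtain ⟨a, rfl⟩ := hb
      rw [lpMapDomain_apply]
      exact (lpMapDomain_apply (σ.trans ρ) f a).symm
    · rw [lpMapDomain_apply_of_notMem _ _ _ hb, lpMapDomain_apply_of_notMem]
      rintro ⟨a, ha⟩
      exact hb ⟨a, ρ.injective ha⟩
  · rw [lpMapDomain_apply_of_notMem _ _ _ hc, lpMapDomain_apply_of_notMem]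
    rintro ⟨a, ha⟩
    exact hc ⟨σ a, ha⟩

theorem adjoint_lpMapDomain_apply {α β : Type*} (σ : α ↪ β) (f : lp (fun _ : β => ℂ) 2) (a : α) :
    adjoint (lpMapDomain σ).toContinuousLinearMap f a = f (σ a) := by
  classical
  rw [lp_apply_eq_inner, lp_apply_eq_inner f, adjoint_inner_right, ← lpMapDomain_single]
  rfl

/-- Translation by `a` on `ℓ²(G)`. -/
noncomputable abbrev lpShift {G : Type*} [Add G] [IsRightCancelAdd G] (a : G) :
    lp (fun _ : G => ℂ) 2 →ₗᵢ[ℂ] lp (fun _ : G => ℂ) 2 :=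
  lpMapDomain (addRightEmbedding a)

theorem lpShift_apply_add {G : Type*} [Add G] [IsRightCancelAdd G] (a : G)
    (f : lp (fun _ : G => ℂ) 2) (g : G) : lpShift a f (g + a) = f g :=
  lpMapDomain_apply (addRightEmbedding a) f g

theorem lpShift_apply {G : Type*} [AddGroup G] (a : G)
    (f : lp (fun _ : G => ℂ) 2) (g : G) : lpShift a f g = f (g - a) := by
  have := lpShift_apply_add a f (g - a)
  rwa [sub_add_cancel] at this

theorem lpShift_lpShift {G : Type*} [AddCommSemigroup G] [IsRightCancelAdd G] (a b : G)
    (f : lp (fun _ : G => ℂ) 2) : lpShift a (lpShift b f) = lpShift (a + b) f := by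
  unfold lpShift
  rw [lpMapDomain_comp]
  congr 2
  ext g
  simp [add_comm a b, add_assoc]

/-- If Bessel's inequality for `e` with respect to an orthonormal family is an equality, then `e` is
orthogonal to everything orthogonal to the family. -/
theorem Orthonormal.inner_eq_zero_of_hasSum_norm_sq {ι E : Type*} [NormedAddCommGroup E]
    [InnerProductSpace ℂ E] [CompleteSpace E] {v : ι → E} (hv : Orthonormal ℂ v) {e y : E}
    (he : HasSum (fun i => ‖⟪v i, e⟫_ℂ‖ ^ 2) (‖e‖ ^ 2)) (hy : ∀ i, ⟪v i, y⟫_ℂ = 0) :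
    ⟪y, e⟫_ℂ = 0 := by
  set z := (ℂ ∙ y)ᗮ.starProjection e with hz
  have hvi : ∀ i, v i ∈ (ℂ ∙ y)ᗮ := fun i => by
    rw [Submodule.mem_orthogonal_singleton_iff_inner_left]; exact hy i
  have hvz : ∀ i, ⟪v i, z⟫_ℂ = ⟪v i, e⟫_ℂ := fun i => by
    rw [hz, ← Submodule.inner_starProjection_left_eq_right,
      Submodule.starProjection_eq_self_iff.mpr (hvi i)]
  have hb : ‖e‖ ^ 2 ≤ ‖z‖ ^ 2 := by
    rw [← he.tsum_eq]
    simp_rw [← hvz]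
    exact hv.tsum_inner_products_le z
  have hp : ‖z‖ ^ 2 + ‖e - z‖ ^ 2 = ‖e‖ ^ 2 := by
    have h0 : ⟪z, e - z⟫_ℂ = 0 := by
      rw [← inner_conj_symm, hz, Submodule.starProjection_inner_eq_zero _ _
        (Submodule.starProjection_apply_mem _ _), map_zero]
    have := norm_add_sq_eq_norm_sq_add_norm_sq_of_inner_eq_zero z (e - z) h0
    rw [add_sub_cancel] at this
    nlinarith
  have h1 : e - z = 0 := by
    rw [← norm_eq_zero]
    nlinarith [sq_nonneg ‖e - z‖]
  have h2 : e ∈ (ℂ ∙ y)ᗮ := by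
    rw [sub_eq_zero.mp h1]; exact Submodule.starProjection_apply_mem _ _
  rwa [Submodule.mem_orthogonal_singleton_iff_inner_right] at h2

/-- Over a linearly ordered group, the translates of a vector of `ℓ²(G)` whose support has a least
element span a dense subspace. -/
theorem eq_zero_of_forall_inner_lpShift_eq_zero {G : Type*} [AddCommGroup G] [LinearOrder G]
    [IsOrderedAddMonoid G] {x y : lp (fun _ : G => ℂ) 2} {g₀ : G} (hx : x g₀ ≠ 0)
    (hmin : ∀ g < g₀, x g = 0) (h : ∀ a, ⟪lpShift a x, y⟫_ℂ = 0) : y = 0 := by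
  classical
  set K : Submodule ℂ (lp (fun _ : G => ℂ) 2) :=
    (Submodule.span ℂ {z | ∃ a, 0 < a ∧ z = lpShift a x}).topologicalClosure with hK
  have hKc : IsClosed (K : Set (lp (fun _ : G => ℂ) 2)) := Submodule.isClosed_topologicalClosure _
  have : CompleteSpace K := hKc.completeSpace_coe
  have key : ∀ (T : lp (fun _ : G => ℂ) 2 →L[ℂ] lp (fun _ : G => ℂ) 2)
      (U : Submodule ℂ (lp (fun _ : G => ℂ) 2)), IsClosed (U : Set (lp (fun _ : G => ℂ) 2)) →
      (∀ a, 0 < a → T (lpShift a x) ∈ U) → ∀ z ∈ K, T z ∈ U := by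
    intro T U hU hT z hz
    have : K ≤ U.comap T.toLinearMap := by
      refine Submodule.topologicalClosure_minimal _ ?_ (hU.preimage T.continuous)
      rw [Submodule.span_le]
      rintro _ ⟨a, ha, rfl⟩
      exact hT a ha
    exact this hz
  have hmem : ∀ a, 0 < a → lpShift a x ∈ K := fun a ha =>
    Submodule.le_topologicalClosure _ (Submodule.subset_span ⟨a, ha, rfl⟩)
  have hK0 : ∀ z ∈ K, z g₀ = 0 := by
    intro z hz
    have := key (ContinuousLinearMap.id ℂ _)
      (ℂ ∙ (lp.single 2 g₀ (1 : ℂ) : lp (fun _ : G => ℂ) 2))ᗮ (Submodule.isClosed_orthogonal _)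
      (fun a ha => by
        rw [Submodule.mem_orthogonal_singleton_iff_inner_right, ← lp_apply_eq_inner]
        change lpShift a x g₀ = 0
        rw [lpShift_apply]
        exact hmin _ (sub_lt_self _ ha)) z hz
    rwa [Submodule.mem_orthogonal_singleton_iff_inner_right, ← lp_apply_eq_inner] at this
  have hKshift : ∀ b, 0 < b → ∀ z ∈ K, lpShift b z ∈ K := fun b hb =>
    key (lpShift b).toContinuousLinearMap K hKc fun a ha => by
      change lpShift b (lpShift a x) ∈ K
      rw [lpShift_lpShift]
      exact hmem _ (add_pos hb ha)
  have hKy : ∀ b, ∀ z ∈ K, ⟪lpShift b z, y⟫_ℂ = 0 := fun b z hz => by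
    have := key (lpShift b).toContinuousLinearMap (ℂ ∙ y)ᗮ (Submodule.isClosed_orthogonal _)
      (fun a ha => by
        change lpShift b (lpShift a x) ∈ _
        rw [lpShift_lpShift, Submodule.mem_orthogonal_singleton_iff_inner_left]
        exact h _) z hz
    rwa [Submodule.mem_orthogonal_singleton_iff_inner_left] at this
  set p := K.starProjection x with hp
  have hpK : p ∈ K := Submodule.starProjection_apply_mem _ _
  set θ := x - p with hθ
  have hθK : ∀ z ∈ K, ⟪z, θ⟫_ℂ = 0 := fun z hz => by
    rw [← inner_conj_symm, hθ, hp, Submodule.starProjection_inner_eq_zero _ _ hz, map_zero]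
  have hθ0 : θ ≠ 0 := fun h0 => by
    have : θ g₀ = 0 := by rw [h0]; rfl
    rw [hθ] at this
    change x g₀ - p g₀ = 0 at this
    rw [hK0 p hpK, sub_zero] at this
    exact hx this
  have hpos : ∀ b, 0 < b → ⟪lpShift b θ, θ⟫_ℂ = 0 := fun b hb => by
    refine hθK _ ?_
    rw [hθ, map_sub]
    exact K.sub_mem (hmem b hb) (hKshift b hb p hpK)
  have hlt : ∀ a b, a < b → ⟪lpShift b θ, lpShift a θ⟫_ℂ = 0 := fun a b hab => by
    rw [← add_sub_cancel a b, ← lpShift_lpShift, LinearIsometry.inner_map_map]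
    exact hpos _ (sub_pos.mpr hab)
  have hn : ‖θ‖ ≠ 0 := norm_ne_zero_iff.mpr hθ0
  set v : G → lp (fun _ : G => ℂ) 2 := fun a => ((‖θ‖⁻¹ : ℝ) : ℂ) • lpShift a θ with hv
  have hvo : Orthonormal ℂ v := by
    refine ⟨fun a => ?_, fun a b hab => ?_⟩
    · rw [hv]
      simp only [norm_smul, LinearIsometry.norm_map, Complex.norm_real, norm_inv, norm_norm]
      exact inv_mul_cancel₀ hn
    · simp only [hv, inner_smul_left, inner_smul_right]
      rcases lt_or_gt_of_ne hab with h' | h'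
      · rw [← inner_conj_symm (lpShift a θ), hlt a b h']; simp
      · rw [hlt b a h']; simp
  have hvy : ∀ a, ⟪v a, y⟫_ℂ = 0 := fun a => by
    simp only [hv, inner_smul_left]
    rw [hθ, map_sub, inner_sub_left, h, hKy a p hpK]
    simp
  ext g
  have hsum : HasSum (fun a => ‖⟪v a, (lp.single 2 g (1 : ℂ) : lp (fun _ : G => ℂ) 2)⟫_ℂ‖ ^ 2)
      (‖(lp.single 2 g (1 : ℂ) : lp (fun _ : G => ℂ) 2)‖ ^ 2) := by
    have h1 : HasSum (fun a => ‖θ a‖ ^ 2) (‖θ‖ ^ 2) := by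
      have := lp.hasSum_norm (p := 2) (by norm_num) θ
      simpa using this
    have h2 := ((Equiv.subLeft g).hasSum_iff.mpr h1).mul_left ((‖θ‖⁻¹) ^ 2)
    have h3 : ‖(lp.single 2 g (1 : ℂ) : lp (fun _ : G => ℂ) 2)‖ ^ 2 =
        (‖θ‖⁻¹) ^ 2 * ‖θ‖ ^ 2 := by
      rw [lp.norm_single (by norm_num), ← mul_pow, inv_mul_cancel₀ hn]; simp
    have h4 : ∀ a, ‖⟪v a, (lp.single 2 g (1 : ℂ) : lp (fun _ : G => ℂ) 2)⟫_ℂ‖ ^ 2 =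
        (‖θ‖⁻¹) ^ 2 * ‖θ (g - a)‖ ^ 2 := fun a => by
      rw [← inner_conj_symm, ← lp_apply_eq_inner]
      have : v a g = ((‖θ‖⁻¹ : ℝ) : ℂ) * lpShift a θ g := rfl
      rw [this, lpShift_apply]
      simp [mul_pow]
    rw [h3, funext h4]
    exact h2
  have := hvo.inner_eq_zero_of_hasSum_norm_sq hsum hvy
  rw [← inner_conj_symm, ← lp_apply_eq_inner] at this
  simpa using this

theorem lpShift_adjoint_apply {n : ℕ} (i : Fin n) (m : ℕ) (f : PolyHardy n) (k : Fin n → ℕ) :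
    lpShift (Pi.single i m) (adjoint (lpShift (Pi.single i m)).toContinuousLinearMap f) k =
      if m ≤ k i then f k else 0 := by
  split_ifs with h
  · have hk : k = (k - Pi.single i m) + Pi.single i m := by
      ext j
      by_cases hj : j = i
      · subst hj; simp [h]
      · simp [hj]
    rw [hk, lpShift_apply_add, adjoint_lpMapDomain_apply]
    rfl
  · exact lpMapDomain_apply_of_notMem _ _ _ fun ⟨k', hk'⟩ => h (by simp [← hk'])

theorem lpShift_single_apply_of_lt {n : ℕ} (i : Fin n) (m : ℕ) (f : PolyHardy n) (k : Fin n → ℕ)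
    (h : k i < m) : lpShift (Pi.single i m) f k = 0 :=
  lpMapDomain_apply_of_notMem _ _ _ fun ⟨k', hk'⟩ => h.not_ge (by simp [← hk'])

/-- The vectors of `ℓ²(ℕⁿ)` supported in the box `[0, N)ⁿ`. -/
def boxSupported (n N : ℕ) : Submodule ℂ (PolyHardy n) where
  carrier := {f | ∀ k : Fin n → ℕ, (∃ i, N ≤ k i) → f k = 0}
  add_mem' {f g} hf hg k hk := by
    change f k + g k = 0
    rw [hf k hk, hg k hk, add_zero]
  zero_mem' k _ := rfl
  smul_mem' c f hf k hk := by
    change c * f k = 0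
    rw [hf k hk, mul_zero]

instance (n N : ℕ) : FiniteDimensional ℂ (boxSupported n N) := by
  let φ : boxSupported n N →ₗ[ℂ] ((Fin n → Fin N) → ℂ) :=
    { toFun f k := (f : PolyHardy n) fun i => k i
      map_add' _ _ := rfl
      map_smul' _ _ := rfl }
  refine FiniteDimensional.of_injective φ ((injective_iff_map_eq_zero φ).mpr fun f hf => ?_)
  ext k
  by_cases hk : ∃ i, N ≤ k i
  · exact f.2 k hk
  · push Not at hk
    exact congrFun hf fun i => ⟨k i, hk i⟩

section Invariant

variable {n : ℕ} {S : Submodule ℂ (PolyHardy n)} [CompleteSpace S]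
  {A : StarSubalgebra ℂ (S →L[ℂ] S)}

theorem exists_mem_coe_eq_lpShift
    (hR : ∀ i : Fin n, ∃ R ∈ A, ∀ x : S, (R x : PolyHardy n) = lpShift (Pi.single i 1) x)
    (a : Fin n → ℕ) : ∃ R ∈ A, ∀ x : S, (R x : PolyHardy n) = lpShift a x := by
  let B : AddSubmonoid (Fin n → ℕ) :=
    { carrier := {a | ∃ R ∈ A, ∀ x : S, (R x : PolyHardy n) = lpShift a x}
      add_mem' := by
        rintro a b ⟨R, hR, h⟩ ⟨Q, hQ, h'⟩
        refine ⟨R * Q, mul_mem hR hQ, fun x => ?_⟩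
        rw [← lpShift_lpShift, ← h', ← h]
        rfl
      zero_mem' := by
        refine ⟨1, one_mem A, fun x => ?_⟩
        ext k
        exact (lpShift_apply_add 0 (x : PolyHardy n) k).symm }
  have ha : a = ∑ i, a i • Pi.single i 1 := by
    ext j
    simp [Finset.sum_apply, Pi.single_apply]
  change a ∈ B
  rw [ha]
  exact sum_mem fun i _ => nsmul_mem (hR i) _

/-- The embedding of `ℕⁿ` into `ℤⁿ` with the lexicographic order. -/
def natLexEmbedding (n : ℕ) : (Fin n → ℕ) ↪ Lex (Fin n → ℤ) where
  toFun k := toLex fun i => (k i : ℤ)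
  inj' a b h := by
    ext i
    exact Int.ofNat.inj (congrFun h i)

theorem lpShift_lpMapDomain_natLexEmbedding (a : Fin n → ℕ) (f : PolyHardy n) :
    lpShift (natLexEmbedding n a) (lpMapDomain (natLexEmbedding n) f) =
      lpMapDomain (natLexEmbedding n) (lpShift a f) := by
  unfold lpShift
  rw [lpMapDomain_comp, lpMapDomain_comp]
  congr 2

theorem exists_min_support {f : PolyHardy n} (hf : f ≠ 0) :
    ∃ k, f k ≠ 0 ∧ ∀ j, natLexEmbedding n j < natLexEmbedding n k → f j = 0 := by
  have hne : ∃ k : Lex (Fin n → ℕ), f (ofLex k) ≠ 0 := by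
    by_contra! h
    exact hf (lp.ext (funext fun k => h (toLex k)))
  obtain ⟨k, hk, hmin⟩ := WellFounded.has_min
    (wellFounded_lt : WellFounded ((· < ·) : Lex (Fin n → ℕ) → Lex (Fin n → ℕ) → Prop))
    {k | f (ofLex k) ≠ 0} hne
  refine ⟨ofLex k, hk, fun j hj => ?_⟩
  by_contra hfj
  refine hmin (toLex j) hfj ?_
  obtain ⟨i, h1, h2⟩ := hj
  exact ⟨i, fun l hl => Int.ofNat.inj (h1 l hl), Int.ofNat_lt.mp h2⟩

/-- Every nonzero vector is cyclic for a star algebra of operators on `S` containing the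
restrictions of the coordinate shifts. -/
theorem eq_zero_of_forall_inner_eq_zero
    (hR : ∀ i : Fin n, ∃ R ∈ A, ∀ x : S, (R x : PolyHardy n) = lpShift (Pi.single i 1) x)
    {x y : S} (hx : x ≠ 0) (hxy : ∀ a ∈ A, ⟪a x, y⟫_ℂ = 0) : y = 0 := by
  obtain ⟨k, hk, hmin⟩ := exists_min_support (f := (x : PolyHardy n)) (by simpa using hx)
  set J := lpMapDomain (natLexEmbedding n) with hJ
  have h0 : J (y : PolyHardy n) = 0 := by
    refine eq_zero_of_forall_inner_lpShift_eq_zero (x := J (x : PolyHardy n))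
      (g₀ := natLexEmbedding n k) ?_ (fun g hg => ?_) fun α => ?_
    · rwa [hJ, lpMapDomain_apply]
    · by_cases hgr : g ∈ Set.range (natLexEmbedding n)
      · obtain ⟨j, rfl⟩ := hgr
        rw [hJ, lpMapDomain_apply]
        exact hmin j hg
      · exact lpMapDomain_apply_of_notMem _ _ _ hgr
    · obtain ⟨Ra, hRa, ha⟩ := exists_mem_coe_eq_lpShift hR fun i => (α i).toNat
      obtain ⟨Rb, hRb, hb⟩ := exists_mem_coe_eq_lpShift hR fun i => (-α i).toNat
      have hab : natLexEmbedding n (fun i => (-α i).toNat) + α =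
          natLexEmbedding n fun i => (α i).toNat := by
        funext i
        change (((-α i).toNat : ℕ) : ℤ) + α i = (((α i).toNat : ℕ) : ℤ)
        omega
      rw [← LinearIsometry.inner_map_map (lpShift (natLexEmbedding n fun i => (-α i).toNat)),
        lpShift_lpShift, hab, hJ, lpShift_lpMapDomain_natLexEmbedding,
        lpShift_lpMapDomain_natLexEmbedding, LinearIsometry.inner_map_map, ← ha, ← hb]
      have := hxy (star Rb * Ra) (mul_mem (star_mem hRb) hRa)
      change ⟪adjoint Rb (Ra x), y⟫_ℂ = 0 at this
      rwa [adjoint_inner_left] at this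
  have : (y : PolyHardy n) = 0 := J.injective (by rw [h0, map_zero])
  exact_mod_cast this

theorem exists_mem_apply_ne_zero_of_finset [FiniteDimensional ℂ Sᗮ]
    (hR : ∀ i : Fin n, ∃ R ∈ A, ∀ x : S, (R x : PolyHardy n) = lpShift (Pi.single i 1) x)
    {x : S} (hx : x ≠ 0) (s : Finset (Fin n)) :
    ∃ F ∈ A, F x ≠ 0 ∧ ∃ (N : ℕ) (W : Submodule ℂ (PolyHardy n)), FiniteDimensional ℂ W ∧
      ∀ u : S, ∃ w ∈ W, ∀ k : Fin n → ℕ, (∃ i ∈ s, N ≤ k i) → (F u : PolyHardy n) k = w k := by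
  induction s using Finset.induction_on with
  | empty => exact ⟨1, one_mem A, hx, 0, ⊥, inferInstance, fun u => ⟨0, zero_mem _, by simp⟩⟩
  | insert i s _ ih =>
    obtain ⟨F, hFA, hFx, N, W, hW, hFW⟩ := ih
    obtain ⟨k₀, hk₀⟩ : ∃ k, (F x : PolyHardy n) k ≠ 0 := by
      by_contra! h
      exact hFx (Subtype.ext (lp.ext (funext h)))
    set m := max N (k₀ i + 1) with hm
    obtain ⟨R, hRA, hRm⟩ := exists_mem_coe_eq_lpShift hR (Pi.single i m)
    set V : PolyHardy n →L[ℂ] PolyHardy n :=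
      (lpShift (Pi.single i m : Fin n → ℕ)).toContinuousLinearMap with hV
    have hRV : ∀ u : S, (R u : PolyHardy n) = V u := hRm
    set D : PolyHardy n →L[ℂ] PolyHardy n := 1 - V ∘L adjoint V with hD
    have hDk : ∀ f k, D f k = if m ≤ k i then 0 else f k := fun f k => by
      change f k - V (adjoint V f) k = _
      have : V (adjoint V f) k = if m ≤ k i then f k else 0 := lpShift_adjoint_apply i m f k
      rw [this]
      split_ifs <;> simp
    have hq : ∀ u : S, adjoint V u - (adjoint R u : S) ∈ Sᗮ := fun u => by
      rw [Submodule.mem_orthogonal]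
      intro t ht
      have h1 : ⟪t, ((adjoint R u : S) : PolyHardy n)⟫_ℂ = ⟪V t, (u : PolyHardy n)⟫_ℂ := by
        have := adjoint_inner_right R ⟨t, ht⟩ u
        rw [Submodule.coe_inner, Submodule.coe_inner, hRV] at this
        exact this
      rw [inner_sub_right, h1, adjoint_inner_right, sub_self]
    have hT : ∀ u : S, (((1 - R * star R) u : S) : PolyHardy n) =
        D u + V (adjoint V u - (adjoint R u : S)) := fun u => by
      change (u : PolyHardy n) - (R (adjoint R u) : S) =
        ((u : PolyHardy n) - V (adjoint V u)) + V (adjoint V u - (adjoint R u : S))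
      rw [hRV, map_sub]
      abel
    refine ⟨(1 - R * star R) * F, mul_mem (sub_mem (one_mem A) (mul_mem hRA (star_mem hRA))) hFA,
      fun h0 => hk₀ ?_, m, W.map D.toLinearMap ⊔ Sᗮ.map V.toLinearMap, inferInstance,
      fun u => ?_⟩
    · have h1 : (((1 - R * star R) (F x) : S) : PolyHardy n) k₀ = 0 := by
        have h2 : (1 - R * star R) (F x) = 0 := h0
        rw [h2]
        rfl
      rw [hT] at h1
      change D (F x) k₀ + V _ k₀ = 0 at h1
      have hlt : k₀ i < m := by omega
      have h3 : V (adjoint V (F x) - (adjoint R (F x) : S)) k₀ = 0 :=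
        lpShift_single_apply_of_lt i m _ k₀ hlt
      rwa [h3, hDk, if_neg hlt.not_ge, add_zero] at h1
    · obtain ⟨w, hw, hwk⟩ := hFW u
      refine ⟨D w + V (adjoint V (F u) - (adjoint R (F u) : S)),
        Submodule.add_mem_sup ⟨w, hw, rfl⟩ ⟨_, hq (F u), rfl⟩, fun k hk => ?_⟩
      change (((1 - R * star R) (F u) : S) : PolyHardy n) k = _
      rw [hT]
      change D (F u) k + V _ k = D w k + V _ k
      congr 1
      rw [hDk, hDk]
      split_ifs with hki
      · rfl
      · obtain ⟨j, hj, hjk⟩ := hk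
        rcases Finset.mem_insert.mp hj with rfl | hj
        · exact absurd hjk hki
        · exact hwk k ⟨j, hj, by omega⟩

/-- A star algebra of operators on an invariant subspace of finite codimension containing the
restrictions of the coordinate shifts contains a nonzero finite-rank operator. -/
theorem exists_mem_ne_zero_finiteDimensional_range [FiniteDimensional ℂ Sᗮ] [Nontrivial S]
    (hR : ∀ i : Fin n, ∃ R ∈ A, ∀ x : S, (R x : PolyHardy n) = lpShift (Pi.single i 1) x) :
    ∃ F ∈ A, F ≠ 0 ∧ FiniteDimensional ℂ F.range := by
  obtain ⟨x, hx⟩ := exists_ne (0 : S)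
  obtain ⟨F, hFA, hFx, N, W, hW, hFW⟩ := exists_mem_apply_ne_zero_of_finset hR hx Finset.univ
  refine ⟨F, hFA, fun h => hFx (by rw [h]; rfl), ?_⟩
  have hle : F.range.map S.subtype ≤ W ⊔ boxSupported n N := by
    rintro _ ⟨_, ⟨u, rfl⟩, rfl⟩
    obtain ⟨w, hw, hwk⟩ := hFW u
    have h1 : (F u : PolyHardy n) - w ∈ boxSupported n N := fun k ⟨i, hi⟩ =>
      sub_eq_zero.mpr (hwk k ⟨i, Finset.mem_univ i, hi⟩)
    have h2 := Submodule.add_mem_sup hw h1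
    rwa [add_sub_cancel] at h2
  have : FiniteDimensional ℂ (F.range.map S.subtype) := Submodule.finiteDimensional_of_le hle
  exact (Submodule.equivMapOfInjective S.subtype S.injective_subtype F.range).symm.finiteDimensional

end Invariant

/-- If `S` is an invariant subspace of finite codimension in `H²(𝔻ⁿ)`, then every compact
operator on `S` belongs to the `C^*`-algebra `T(S)` generated by the compressed shifts. -/
theorem stmt12 {n : ℕ} (hn : 2 ≤ n)
    (Mz : Fin n → (PolyHardy n →L[ℂ] PolyHardy n))
    (hMz : ∀ (i : Fin n) (f : PolyHardy n) (k : Fin n → ℕ),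
      Mz i f k = if k i = 0 then 0 else f (Function.update k i (k i - 1)))
    (S : Submodule ℂ (PolyHardy n)) (hS : IsClosed (S : Set (PolyHardy n)))
    (hinv : ∀ (i : Fin n), ∀ x ∈ S, Mz i x ∈ S)
    (hcodim : FiniteDimensional ℂ ↥Sᗮ) :
    ∀ T : ↥S →L[ℂ] ↥S, IsCompactOperator ⇑T →
      T ∈ TalgGen S hS fun i => compressS S hS (Mz i) := by
  intro T hT
  have : CompleteSpace S := hS.completeSpace_coe
  obtain ⟨A, hA, hAc, hRA⟩ :=
    exists_starSubalgebra_coe_eq_genCStar (Set.range fun i => compressS S hS (Mz i))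
  change T ∈ genCStar (Set.range fun i => compressS S hS (Mz i))
  rw [← hA, SetLike.mem_coe]
  rcases subsingleton_or_nontrivial S with hsub | hnt
  · rw [show T = 0 from ContinuousLinearMap.ext fun x => Subsingleton.elim _ _]
    exact zero_mem A
  have hshift : ∀ i f, Mz i f = lpShift (Pi.single i 1) f := fun i f => by
    ext k
    rw [hMz]
    split_ifs with hk
    · exact (lpShift_single_apply_of_lt i 1 f k (by omega)).symm
    · have hk' : k = Function.update k i (k i - 1) + Pi.single i 1 := by
        ext j
        by_cases hj : j = i
        · subst hj
          simp only [Pi.add_apply, Function.update_self, Pi.single_eq_same]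
          omega
        · simp [hj]
      conv_rhs => rw [hk']
      exact (lpShift_apply_add _ f _).symm
  have hR : ∀ i : Fin n, ∃ R ∈ A, ∀ x : S, (R x : PolyHardy n) = lpShift (Pi.single i 1) x := by
    refine fun i => ⟨compressS S hS (Mz i), hRA _ ⟨i, rfl⟩, fun x => ?_⟩
    rw [← hshift]
    exact Submodule.starProjection_eq_self_iff.mpr (hinv i x x.2)
  exact isCompactOperator_mem_of_irreducible hAc
    (fun x y hx h => eq_zero_of_forall_inner_eq_zero hR hx h)
    (exists_mem_ne_zero_finiteDimensional_range hR) hT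
end

section
/- Suppose M₁ and M₂ are invariant subspaces of H²(𝔻ⁿ) with M₁ ⊆ M₂, where M₁ has finite codimension in H²(𝔻ⁿ) (so in particular dim(M₂ ⊖ M₁) < ∞). Then T(M₁) = { P^{M₂}_{M₁} T |_{M₁} : T ∈ T(M₂) }, where P^{M₂}_{M₁} : M₂ → M₁ denotes the orthogonal projection of M₂ onto M₁ and the equality is as subsets of B(M₁). -/
open ContinuousLinearMap

/-- The compression `P^{M₂}_{M₁} T|_{M₁}` of `T ∈ B(M₂)` to a closed subspace `M₁ ⊆ M₂`. -/
noncomputable def compressNested {n : ℕ} (M₁ M₂ : Submodule ℂ (PolyHardy n)) (h12 : M₁ ≤ M₂)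
    (hM₁ : IsClosed (M₁ : Set (PolyHardy n))) (T : ↥M₂ →L[ℂ] ↥M₂) : ↥M₁ →L[ℂ] ↥M₁ :=
  haveI : CompleteSpace ↥M₁ := hM₁.completeSpace_coe
  (Submodule.orthogonalProjectionOnto M₁ ∘L M₂.subtypeL) ∘L
    (T ∘L ContinuousLinearMap.codRestrict M₁.subtypeL M₂ fun x => h12 x.2)


section FiniteRank

variable {E F G : Type*} [NormedAddCommGroup E] [InnerProductSpace ℂ E]
  [NormedAddCommGroup F] [InnerProductSpace ℂ F] [NormedAddCommGroup G] [InnerProductSpace ℂ G]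

/-- A bounded operator has finite rank if its range is finite-dimensional. -/
def FiniteRank (T : E →L[ℂ] F) : Prop :=
  FiniteDimensional ℂ (LinearMap.range (T : E →ₗ[ℂ] F))

theorem FiniteRank.of_forall_mem {T : E →L[ℂ] F} (W : Submodule ℂ F) [FiniteDimensional ℂ W]
    (h : ∀ x, T x ∈ W) : FiniteRank T :=
  Submodule.finiteDimensional_of_le (S₂ := W) (by rintro _ ⟨x, rfl⟩; exact h x)

theorem FiniteRank.comp_left {T : E →L[ℂ] F} (hT : FiniteRank T) (S : F →L[ℂ] G) :
    FiniteRank (S ∘L T) := by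
  have : FiniteDimensional ℂ (LinearMap.range (T : E →ₗ[ℂ] F)) := hT
  exact .of_forall_mem ((LinearMap.range (T : E →ₗ[ℂ] F)).map (S : F →ₗ[ℂ] G))
    fun x => ⟨T x, ⟨x, rfl⟩, rfl⟩

theorem FiniteRank.comp_right {T : F →L[ℂ] G} (hT : FiniteRank T) (S : E →L[ℂ] F) :
    FiniteRank (T ∘L S) := by
  have : FiniteDimensional ℂ (LinearMap.range (T : F →ₗ[ℂ] G)) := hT
  exact .of_forall_mem (LinearMap.range (T : F →ₗ[ℂ] G)) fun x => ⟨S x, rfl⟩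

theorem FiniteRank.eq_sum_rankOne [CompleteSpace E] [CompleteSpace F] {T : E →L[ℂ] F}
    (hT : FiniteRank T) : ∃ (m : ℕ) (b : Fin m → F),
      T = ∑ i, InnerProductSpace.rankOne ℂ (b i) (adjoint T (b i)) := by
  have : FiniteDimensional ℂ (LinearMap.range (T : E →ₗ[ℂ] F)) := hT
  let b := stdOrthonormalBasis ℂ (LinearMap.range (T : E →ₗ[ℂ] F))
  refine ⟨_, fun i => (b i : F), ?_⟩
  ext x
  have h := congrArg Subtype.val (b.sum_repr' ⟨T x, ⟨x, rfl⟩⟩)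
  simpa [adjoint_inner_left, sum_apply] using h.symm

end FiniteRank

section Irreducible

variable {E : Type*} [NormedAddCommGroup E] [InnerProductSpace ℂ E]

/-- A nonzero finite-rank element of minimal rank in an algebra of operators compresses every
element of the algebra to a scalar multiple of itself. -/
theorem exists_minimal_rank (A : Subalgebra ℂ (E →L[ℂ] E))
    (hA : ∃ T ∈ A, T ≠ 0 ∧ FiniteRank T) :
    ∃ P ∈ A, P ≠ 0 ∧ ∀ T ∈ A, ∃ μ : ℂ, P * T * P = μ • P := by
  classical
  obtain ⟨P, ⟨hPA, hP0, hPf⟩, hmin⟩ := WellFounded.has_min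
    (measure fun T : E →L[ℂ] E => Module.finrank ℂ (LinearMap.range (T : E →ₗ[ℂ] E))).wf
    {T | T ∈ A ∧ T ≠ 0 ∧ FiniteRank T} hA
  refine ⟨P, hPA, hP0, fun T hT => ?_⟩
  set V := LinearMap.range (P : E →ₗ[ℂ] E) with hV
  have hfin : FiniteDimensional ℂ V := hPf
  have hnt : Nontrivial V := by
    rw [Submodule.nontrivial_iff_ne_bot, hV, Ne, LinearMap.range_eq_bot]
    exact fun h => hP0 (ContinuousLinearMap.coe_injective h)
  let f : Module.End ℂ V :=
    ((P * T : E →L[ℂ] E) : E →ₗ[ℂ] E).restrict (p := V) (q := V) fun x _ => ⟨T x, rfl⟩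
  obtain ⟨μ, hμ⟩ := Module.End.exists_eigenvalue f
  obtain ⟨v, hv⟩ := hμ.exists_hasEigenvector
  refine ⟨μ, ?_⟩
  by_contra hne
  let Q := P * T * P - μ • P
  have hQA : Q ∈ A := sub_mem (mul_mem (mul_mem hPA hT) hPA) (A.smul_mem hPA μ)
  have hQV : ∀ x, Q x ∈ V := fun x => V.sub_mem ⟨T (P x), rfl⟩ (V.smul_mem μ ⟨x, rfl⟩)
  have hle : LinearMap.range (Q : E →ₗ[ℂ] E) ≤ V := by rintro _ ⟨x, rfl⟩; exact hQV x
  have hr := hmin Q ⟨hQA, sub_ne_zero.2 hne, .of_forall_mem V hQV⟩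
  have heq := Submodule.eq_of_le_of_finrank_le hle (not_lt.1 hr)
  have hsurj : Function.Surjective (f - algebraMap ℂ (Module.End ℂ V) μ) := by
    rintro ⟨y, hy⟩
    rw [← heq] at hy
    obtain ⟨x, rfl⟩ := hy
    exact ⟨⟨P x, x, rfl⟩, rfl⟩
  have hinj := LinearMap.injective_iff_surjective.2 hsurj
  refine hv.2 (hinj ?_)
  simp [hv.apply_eq_smul]

/-- A closed star algebra of operators with no nontrivial reducing subspace which contains a
nonzero finite-rank operator contains all finite-rank operators. -/
theorem finiteRank_mem_of_irreducible [CompleteSpace E] (A : StarSubalgebra ℂ (E →L[ℂ] E))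
    (hcl : IsClosed (A : Set (E →L[ℂ] E)))
    (hirr : ∀ u v : E, u ≠ 0 → (∀ T ∈ A, inner ℂ v (T u) = 0) → v = 0)
    (hA : ∃ T ∈ A, T ≠ 0 ∧ FiniteRank T) {T : E →L[ℂ] E} (hT : FiniteRank T) : T ∈ A := by
  have hdense : ∀ u : E, u ≠ 0 → Dense ((fun T : E →L[ℂ] E => T u) '' (A : Set (E →L[ℂ] E))) := by
    intro u hu
    let L : (E →L[ℂ] E) →ₗ[ℂ] E := (ContinuousLinearMap.apply ℂ E u : (E →L[ℂ] E) →L[ℂ] E)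
    have : (A.toSubalgebra.toSubmodule.map L).topologicalClosure = ⊤ := by
      rw [Submodule.topologicalClosure_eq_top_iff, eq_bot_iff]
      intro v hv
      refine hirr u v hu fun S hS => ?_
      exact (Submodule.mem_orthogonal' _ _).1 hv _ ⟨S, hS, rfl⟩
    exact Submodule.dense_iff_topologicalClosure_eq_top.2 this
  obtain ⟨P, hPA, hP0, hP⟩ := exists_minimal_rank A.toSubalgebra hA
  obtain ⟨v, hv⟩ : ∃ v, P v ≠ 0 := by
    by_contra! h
    exact hP0 (ContinuousLinearMap.ext h)
  set u := P v with hu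
  have hPu : ∀ x, P x ∈ Submodule.span ℂ {u} := by
    intro x
    have hc : IsClosed {x | P x ∈ Submodule.span ℂ {u}} :=
      (Submodule.closed_of_finiteDimensional (Submodule.span ℂ {u})).preimage P.continuous
    refine hc.closure_subset_iff.2 ?_ (hdense u hv x)
    rintro _ ⟨S, hS, rfl⟩
    obtain ⟨μ, hμ⟩ := hP S hS
    exact Submodule.mem_span_singleton.2 ⟨μ, by simpa using (congrArg (fun T => T v) hμ).symm⟩
  obtain ⟨w, hw0, hw⟩ : ∃ w : E, w ≠ 0 ∧ P = InnerProductSpace.rankOne ℂ u w := by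
    have h : P = InnerProductSpace.rankOne ℂ u (((‖u‖ ^ 2 : ℝ) : ℂ)⁻¹ • adjoint P u) := by
      ext x
      obtain ⟨c, hc⟩ := Submodule.mem_span_singleton.1 (hPu x)
      have hn : ((‖u‖ : ℝ) : ℂ) ≠ 0 := by simpa using hv
      simp only [InnerProductSpace.rankOne_apply, inner_smul_left, adjoint_inner_left, ← hc,
        inner_smul_right, inner_self_eq_norm_sq_to_K]
      congr 1
      simp
      field_simp
    refine ⟨_, ?_, h⟩
    intro h0
    rw [h0, map_zero] at h
    exact hP0 h
  have hone : ∀ x y : E, InnerProductSpace.rankOne ℂ x y ∈ A := by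
    have h1 : ∀ S ∈ A, ∀ T ∈ A, InnerProductSpace.rankOne ℂ (S u) (T w) ∈ A := by
      intro S hS T hT
      have : InnerProductSpace.rankOne ℂ (S u) (T w) = S * P * star T := by
        rw [hw]
        ext x
        simp [star_eq_adjoint, adjoint_inner_right]
      rw [this]
      exact mul_mem (mul_mem hS hPA) (star_mem hT)
    have h2 : ∀ S ∈ A, ∀ y, InnerProductSpace.rankOne ℂ (S u) y ∈ A := by
      intro S hS y
      have hc : IsClosed {y | InnerProductSpace.rankOne ℂ (S u) y ∈ A} :=
        hcl.preimage (InnerProductSpace.rankOne ℂ (S u)).continuous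
      refine hc.closure_subset_iff.2 ?_ (hdense w hw0 y)
      rintro _ ⟨T, hT, rfl⟩
      exact h1 S hS T hT
    intro x y
    have hc : IsClosed {x | InnerProductSpace.rankOne ℂ x y ∈ A} :=
      hcl.preimage (ContinuousLinearMap.smulRightL ℂ E E (innerSL ℂ y)).continuous
    refine hc.closure_subset_iff.2 ?_ (hdense u hv x)
    rintro _ ⟨S, hS, rfl⟩
    exact h2 S hS y
  obtain ⟨m, b, hb⟩ := hT.eq_sum_rankOne
  rw [hb]
  exact sum_mem fun i _ => hone _ _

theorem finiteRank_mem_genCStar [CompleteSpace E] {ι : Type*} (R : ι → (E →L[ℂ] E))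
    (hirr : ∀ A : StarSubalgebra ℂ (E →L[ℂ] E), (∀ i, R i ∈ A) →
      ∀ u v : E, u ≠ 0 → (∀ T ∈ A, inner ℂ v (T u) = 0) → v = 0)
    (hex : ∀ A : StarSubalgebra ℂ (E →L[ℂ] E), Nontrivial E → (∀ i, R i ∈ A) →
      ∃ T ∈ A, T ≠ 0 ∧ FiniteRank T) {T : E →L[ℂ] E} (hT : FiniteRank T) :
    T ∈ genCStar (Set.range R) := by
  set A := StarAlgebra.adjoin ℂ (Set.range R) with hA
  have hR : ∀ i, R i ∈ A.topologicalClosure := fun i =>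
    A.le_topologicalClosure (StarAlgebra.subset_adjoin ℂ _ ⟨i, rfl⟩)
  rcases subsingleton_or_nontrivial E with hE | hE
  · rw [Subsingleton.elim T 0]
    exact zero_mem A.topologicalClosure
  · exact finiteRank_mem_of_irreducible _ A.isClosed_topologicalClosure (hirr _ hR)
      (hex _ hE hR) hT

end Irreducible

section Compression

variable {E F : Type*} [NormedAddCommGroup E] [InnerProductSpace ℂ E] [CompleteSpace E]
  [NormedAddCommGroup F] [InnerProductSpace ℂ F] [CompleteSpace F]

/-- If `J : E → F` is an isometric embedding of finite codimension intertwining `R` with `S`,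
then compressing along `J` maps the `C^*`-algebra generated by `S` onto that generated by `R`,
as soon as both contain the finite-rank operators. -/
theorem genCStar_eq_image_compression {ι : Type*} (R : ι → (E →L[ℂ] E))
    (S : ι → (F →L[ℂ] F)) (J : E →L[ℂ] F)
    (hJ : adjoint J ∘L J = 1) (hfin : FiniteRank (1 - J ∘L adjoint J))
    (hRS : ∀ i, S i ∘L J = J ∘L R i)
    (hR : ∀ T : E →L[ℂ] E, FiniteRank T →
      T ∈ genCStar (Set.range R))
    (hS : ∀ T : F →L[ℂ] F, FiniteRank T →
      T ∈ genCStar (Set.range S)) :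
    genCStar (Set.range R) = (fun T => adjoint J ∘L (T ∘L J)) '' genCStar (Set.range S) := by
  unfold genCStar at *
  set A := StarAlgebra.adjoin ℂ (Set.range R) with hAdef
  set B := StarAlgebra.adjoin ℂ (Set.range S) with hBdef
  have hJx : ∀ x, adjoint J (J x) = x := fun x => congrArg (fun T => T x) hJ
  have hRSx : ∀ i x, S i (J x) = J (R i x) := fun i x => congrArg (fun T => T x) (hRS i)
  apply Set.Subset.antisymm
  · intro T hT
    have hext : ∀ T ∈ A, J ∘L (T ∘L adjoint J) ∈ B.topologicalClosure := by
      intro T hT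
      induction hT using StarAlgebra.adjoin_induction with
      | mem x hx =>
        obtain ⟨i, rfl⟩ := hx
        have : J ∘L (R i ∘L adjoint J) = S i - S i * (1 - J ∘L adjoint J) := by
          ext x; simp [hRSx]
        rw [this]
        have hSi : S i ∈ B.topologicalClosure :=
          B.le_topologicalClosure (StarAlgebra.subset_adjoin ℂ _ ⟨i, rfl⟩)
        exact sub_mem hSi (mul_mem hSi (hS _ hfin))
      | algebraMap c =>
        have : J ∘L ((algebraMap ℂ (E →L[ℂ] E) c) ∘L adjoint J) =
            algebraMap ℂ (F →L[ℂ] F) c - algebraMap ℂ (F →L[ℂ] F) c * (1 - J ∘L adjoint J) := by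
          ext x; simp [Algebra.algebraMap_eq_smul_one, smul_sub]
        rw [this]
        exact sub_mem (algebraMap_mem _ c) (mul_mem (algebraMap_mem _ c) (hS _ hfin))
      | add x y _ _ hx hy =>
        have : J ∘L ((x + y) ∘L adjoint J) = J ∘L (x ∘L adjoint J) + J ∘L (y ∘L adjoint J) := by
          ext; simp
        rw [this]
        exact add_mem hx hy
      | mul x y _ _ hx hy =>
        have : J ∘L ((x * y) ∘L adjoint J) =
            (J ∘L (x ∘L adjoint J)) * (J ∘L (y ∘L adjoint J)) := by
          ext; simp [hJx]
        rw [this]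
        exact mul_mem hx hy
      | star x _ hx =>
        have : J ∘L (star x ∘L adjoint J) = star (J ∘L (x ∘L adjoint J)) := by
          simp [star_eq_adjoint, adjoint_comp, comp_assoc]
        rw [this]
        exact star_mem hx
    refine ⟨J ∘L (T ∘L adjoint J), ?_, ?_⟩
    · have hc : Continuous fun T : E →L[ℂ] E => J ∘L (T ∘L adjoint J) := by fun_prop
      exact (B.isClosed_topologicalClosure.preimage hc).closure_subset_iff.2 hext hT
    · ext x; simp [hJx]
  · rintro _ ⟨T, hT, rfl⟩
    have hcomp : ∀ T ∈ B, adjoint J ∘L (T ∘L J) ∈ A.topologicalClosure := by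
      intro T hT
      induction hT using StarAlgebra.adjoin_induction with
      | mem x hx =>
        obtain ⟨i, rfl⟩ := hx
        have : adjoint J ∘L (S i ∘L J) = R i := by ext x; simp [hRSx, hJx]
        rw [this]
        exact A.le_topologicalClosure (StarAlgebra.subset_adjoin ℂ _ ⟨i, rfl⟩)
      | algebraMap c =>
        have : adjoint J ∘L ((algebraMap ℂ (F →L[ℂ] F) c) ∘L J) = algebraMap ℂ (E →L[ℂ] E) c := by
          ext x; simp [Algebra.algebraMap_eq_smul_one, hJx]
        rw [this]
        exact algebraMap_mem _ c
      | add x y _ _ hx hy =>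
        have : adjoint J ∘L ((x + y) ∘L J) = adjoint J ∘L (x ∘L J) + adjoint J ∘L (y ∘L J) := by
          ext; simp
        rw [this]
        exact add_mem hx hy
      | mul x y _ _ hx hy =>
        have : adjoint J ∘L ((x * y) ∘L J) =
            (adjoint J ∘L (x ∘L J)) * (adjoint J ∘L (y ∘L J)) +
              (adjoint J ∘L x) ∘L ((1 - J ∘L adjoint J) ∘L (y ∘L J)) := by
          ext; simp
        rw [this]
        exact add_mem (mul_mem hx hy) (hR _ ((hfin.comp_right _).comp_left _))
      | star x _ hx =>
        have : adjoint J ∘L (star x ∘L J) = star (adjoint J ∘L (x ∘L J)) := by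
          simp [star_eq_adjoint, adjoint_comp, comp_assoc]
        rw [this]
        exact star_mem hx
    have hc : Continuous fun T : F →L[ℂ] F => adjoint J ∘L (T ∘L J) := by fun_prop
    exact (A.isClosed_topologicalClosure.preimage hc).closure_subset_iff.2 hcomp hT

end Compression

section Shift

/-- The power series of an element of the Hardy space. -/
noncomputable def toPowerSeries {n : ℕ} : PolyHardy n →ₗ[ℂ] MvPowerSeries (Fin n) ℂ where
  toFun f := fun m => f m
  map_add' _ _ := rfl
  map_smul' _ _ := rfl

theorem coeff_toPowerSeries {n : ℕ} (f : PolyHardy n) (m : Fin n →₀ ℕ) :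
    MvPowerSeries.coeff m (toPowerSeries f) = f m := rfl

theorem toPowerSeries_injective {n : ℕ} : Function.Injective (toPowerSeries (n := n)) := by
  intro f g h
  ext k
  simpa [coeff_toPowerSeries] using
    congrArg (MvPowerSeries.coeff (Finsupp.equivFunOnFinite.symm k)) h

/-- The coordinate functional `f ↦ f k` on the Hardy space. -/
noncomputable def coordL {n : ℕ} (k : Fin n → ℕ) : PolyHardy n →L[ℂ] ℂ :=
  innerSL ℂ (lp.single 2 k (1 : ℂ) : PolyHardy n)

theorem coordL_apply {n : ℕ} (k : Fin n → ℕ) (f : PolyHardy n) : coordL k f = f k := by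
  simp [coordL, lp.inner_single_left]

theorem clm_ext_single {n : ℕ} {V : Type*} [NormedAddCommGroup V] [NormedSpace ℂ V]
    {S T : PolyHardy n →L[ℂ] V}
    (h : ∀ k : Fin n → ℕ, S (lp.single 2 k (1 : ℂ)) = T (lp.single 2 k (1 : ℂ))) : S = T := by
  ext f
  have hf := lp.hasSum_single (p := 2) (by norm_num) f
  refine (hf.mapL S).unique ?_
  convert hf.mapL T using 2 with k
  have : lp.single (E := fun _ : Fin n → ℕ => ℂ) 2 k (f k) =
      (f k) • (lp.single 2 k (1 : ℂ) : PolyHardy n) := by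
    rw [← lp.single_smul]; simp
  rw [this, map_smul, map_smul, h]

variable {n : ℕ} {Mz : Fin n → (PolyHardy n →L[ℂ] PolyHardy n)}
  (hMz : ∀ (i : Fin n) (f : PolyHardy n) (k : Fin n → ℕ),
      Mz i f k = if k i = 0 then 0 else f (Function.update k i (k i - 1)))

include hMz

theorem shift_single (i : Fin n) (k : Fin n → ℕ) :
    Mz i (lp.single 2 k (1 : ℂ)) = lp.single 2 (Function.update k i (k i + 1)) (1 : ℂ) := by
  ext m
  rw [hMz]
  by_cases h : m = Function.update k i (k i + 1)
  · subst h; simp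
  · rw [lp.single_apply_ne _ _ _ h]
    split_ifs with h0
    · rfl
    · rw [lp.single_apply_ne]
      rintro rfl
      apply h
      simp only [Function.update_self, Function.update_idem]
      rw [Nat.sub_add_cancel (Nat.pos_of_ne_zero h0), Function.update_eq_self]

theorem adjoint_shift_apply (i : Fin n) (f : PolyHardy n) (k : Fin n → ℕ) :
    adjoint (Mz i) f k = f (Function.update k i (k i + 1)) := by
  rw [← coordL_apply, coordL, innerSL_apply_apply, adjoint_inner_right, shift_single hMz,
    ← innerSL_apply_apply, ← coordL, coordL_apply]

theorem adjoint_shift_shift (i : Fin n) (f : PolyHardy n) : adjoint (Mz i) (Mz i f) = f := by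
  ext k
  rw [adjoint_shift_apply hMz, hMz]
  simp

theorem shift_comm (i j : Fin n) (f : PolyHardy n) : Mz i (Mz j f) = Mz j (Mz i f) := by
  rcases eq_or_ne i j with rfl | hij
  · rfl
  ext k
  simp only [hMz, Function.update_of_ne hij, Function.update_of_ne hij.symm,
    Function.update_comm hij]
  split_ifs <;> rfl

theorem adjoint_shift_comm {i j : Fin n} (hij : i ≠ j) (f : PolyHardy n) :
    adjoint (Mz i) (Mz j f) = Mz j (adjoint (Mz i) f) := by
  ext k
  simp only [hMz, adjoint_shift_apply hMz, Function.update_of_ne hij, Function.update_of_ne hij.symm,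
    Function.update_comm hij]

theorem shift_pow_apply_eq_zero (i : Fin n) (m : ℕ) (f : PolyHardy n) (k : Fin n → ℕ)
    (hk : k i < m) : ((Mz i) ^ m) f k = 0 := by
  induction m generalizing k with
  | zero => omega
  | succ m ih =>
    rw [pow_succ', mul_apply_eq_comp, hMz]
    split_ifs with h0
    · rfl
    · exact ih _ (by simp; omega)

theorem toPowerSeries_shift (i : Fin n) (f : PolyHardy n) :
    toPowerSeries (Mz i f) = MvPowerSeries.X i * toPowerSeries f := by
  ext m
  rw [MvPowerSeries.X, MvPowerSeries.coeff_monomial_mul, coeff_toPowerSeries, hMz]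
  simp only [coeff_toPowerSeries, Finsupp.single_le_iff, one_mul]
  by_cases h : m i = 0
  · simp [h]
  · rw [if_neg h, if_pos (by omega)]
    have hupd : Function.update (⇑m) i (m i - 1) =
        ⇑(m - Finsupp.single i 1 : Fin n →₀ ℕ) := by
      funext j
      rcases eq_or_ne j i with rfl | hj
      · simp
      · simp [hj]
    rw [hupd]

theorem toPowerSeries_aeval_shift (i : Fin n) (p : Polynomial ℂ) (f : PolyHardy n) :
    toPowerSeries (Polynomial.aeval (Mz i) p f) =
      Polynomial.aeval (MvPowerSeries.X i : MvPowerSeries (Fin n) ℂ) p * toPowerSeries f := by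
  induction p using Polynomial.induction_on' with
  | add p q hp hq => simp [add_mul, hp, hq]
  | monomial m c =>
    have h : ∀ m, toPowerSeries (((Mz i) ^ m) f) = MvPowerSeries.X i ^ m * toPowerSeries f := by
      intro m
      induction m with
      | zero => simp
      | succ m ih =>
        rw [pow_succ', mul_apply_eq_comp, toPowerSeries_shift hMz, ih, pow_succ',
          mul_assoc]
    rw [Polynomial.aeval_monomial, Polynomial.aeval_monomial, Algebra.algebraMap_eq_smul_one,
      Algebra.algebraMap_eq_smul_one, smul_one_mul, smul_one_mul, smul_apply,
      map_smul, h, smul_mul_assoc]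

theorem aeval_shift_injective (i : Fin n) {p : Polynomial ℂ} (hp : p ≠ 0) {f : PolyHardy n}
    (hf : Polynomial.aeval (Mz i) p f = 0) : f = 0 := by
  have h := toPowerSeries_aeval_shift hMz i p f
  rw [hf, map_zero, eq_comm, mul_eq_zero] at h
  rcases h with h | h
  · exfalso
    have h2 : ((Polynomial.aeval (MvPolynomial.X i : MvPolynomial (Fin n) ℂ) p :
        MvPolynomial (Fin n) ℂ) : MvPowerSeries (Fin n) ℂ) = 0 := by
      rw [← h]
      have := Polynomial.aeval_algHom_apply
        (MvPolynomial.coeToMvPowerSeries.algHom (σ := Fin n) (R := ℂ) ℂ) (MvPolynomial.X i) p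
      simpa [MvPolynomial.coeToMvPowerSeries.algHom_apply] using this.symm
    rw [MvPolynomial.coe_eq_zero_iff] at h2
    exact hp ((transcendental_iff.1 (MvPolynomial.transcendental_X ℂ i)) p h2)
  · exact toPowerSeries_injective (h.trans (map_zero _).symm)

/-- An operator commuting with the shifts is multiplication by a power series. -/
theorem toPowerSeries_of_commute {S : PolyHardy n →L[ℂ] PolyHardy n}
    (hS : ∀ i f, S (Mz i f) = Mz i (S f)) (f : PolyHardy n) :
    toPowerSeries (S f) =
      toPowerSeries (S (lp.single 2 0 (1 : ℂ))) * toPowerSeries f := by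
  have hsingle : ∀ (N : ℕ) (k : Fin n → ℕ), ∑ i, k i = N →
      toPowerSeries (S (lp.single 2 k (1 : ℂ))) =
        toPowerSeries (S (lp.single 2 0 (1 : ℂ))) *
          toPowerSeries (lp.single 2 k (1 : ℂ) : PolyHardy n) := by
    intro N
    induction N with
    | zero =>
      intro k hk
      have : k = 0 := by
        funext i
        simpa using (Finset.sum_eq_zero_iff.1 hk) i (Finset.mem_univ i)
      subst this
      have h1 : toPowerSeries (lp.single 2 0 (1 : ℂ) : PolyHardy n) = 1 := by
        ext m
        rw [coeff_toPowerSeries, MvPowerSeries.coeff_one]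
        split_ifs with h
        · subst h; simp
        · rw [lp.single_apply_ne]
          exact fun h' => h (DFunLike.coe_injective h')
      rw [h1, mul_one]
    | succ N ih =>
      intro k hk
      obtain ⟨i, hi⟩ : ∃ i, k i ≠ 0 := by
        by_contra! h
        simp [h] at hk
      have hk' : k = Function.update (Function.update k i (k i - 1)) i
          ((Function.update k i (k i - 1)) i + 1) := by
        simp [Nat.sub_add_cancel (Nat.pos_of_ne_zero hi)]
      have hsum : ∑ j, Function.update k i (k i - 1) j = N := by
        have h1 := Finset.sum_update_of_mem (Finset.mem_univ i) k (k i - 1)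
        have h2 := Finset.sum_update_of_mem (Finset.mem_univ i) k (k i)
        rw [Function.update_eq_self] at h2
        omega
      rw [hk', ← shift_single hMz, hS, toPowerSeries_shift hMz, toPowerSeries_shift hMz,
        ih _ hsum]
      ring
  ext m
  have hclm : (coordL (m : Fin n → ℕ)) ∘L S =
      ∑ a ∈ Finset.HasAntidiagonal.antidiagonal m,
        (S (lp.single 2 0 (1 : ℂ))) a.1 • coordL (a.2 : Fin n → ℕ) := by
    refine clm_ext_single fun k => ?_
    have h := congrArg (MvPowerSeries.coeff m) (hsingle _ k rfl)
    rw [MvPowerSeries.coeff_mul] at h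
    simpa [coeff_toPowerSeries, coordL_apply, sum_apply] using h
  have h := congrArg (fun T => T f) hclm
  rw [MvPowerSeries.coeff_mul]
  simpa [coeff_toPowerSeries, coordL_apply, sum_apply] using h

theorem eq_zero_of_commute {S : PolyHardy n →L[ℂ] PolyHardy n}
    (hS : ∀ i f, S (Mz i f) = Mz i (S f)) {y : PolyHardy n} (hy : y ≠ 0) (hSy : S y = 0)
    (x : PolyHardy n) : S x = 0 := by
  have h := toPowerSeries_of_commute hMz hS y
  rw [hSy, map_zero, eq_comm, mul_eq_zero] at h
  have hx := toPowerSeries_of_commute hMz hS x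
  rcases h with h | h
  · rw [h, zero_mul] at hx
    exact toPowerSeries_injective (hx.trans (map_zero _).symm)
  · exact absurd (toPowerSeries_injective (h.trans (map_zero _).symm)) hy

end Shift

section InvariantSubspace

theorem FiniteRank.of_forall_coe_mem {E H : Type*} [NormedAddCommGroup E] [InnerProductSpace ℂ E]
    [NormedAddCommGroup H] [InnerProductSpace ℂ H] {M : Submodule ℂ H} {T : E →L[ℂ] M}
    (W : Submodule ℂ H) [FiniteDimensional ℂ W] (h : ∀ x, (T x : H) ∈ W) : FiniteRank T := by
  let L : LinearMap.range (T : E →ₗ[ℂ] M) →ₗ[ℂ] W :=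
    (M.subtype ∘ₗ (LinearMap.range (T : E →ₗ[ℂ] M)).subtype).codRestrict W (by
      rintro ⟨_, x, rfl⟩; exact h x)
  refine FiniteDimensional.of_injective L fun x y hxy => ?_
  exact Subtype.ext (Subtype.ext (congrArg (fun w : W => (w : H)) hxy))

/-- A nonzero polynomial in an operator maps the whole space into a given invariant subspace of
finite codimension. -/
theorem exists_aeval_mem {H : Type*} [NormedAddCommGroup H] [InnerProductSpace ℂ H]
    (M : Submodule ℂ H) [M.HasOrthogonalProjection] [FiniteDimensional ℂ Mᗮ] (T : H →L[ℂ] H)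
    (hT : ∀ x ∈ M, T x ∈ M) :
    ∃ p : Polynomial ℂ, p ≠ 0 ∧ ∀ x, Polynomial.aeval T p x ∈ M := by
  have : FiniteDimensional ℂ (H ⧸ M) :=
    (Submodule.quotientEquivOfIsCompl M Mᗮ M.isCompl_orthogonal).symm.finiteDimensional
  let f : Module.End ℂ (H ⧸ M) := M.mapQ M (T : H →ₗ[ℂ] H) hT
  have hpow : ∀ (m : ℕ) (x : H), (f ^ m) (M.mkQ x) = M.mkQ ((T ^ m) x) := by
    intro m
    induction m with
    | zero => simp
    | succ m ih =>
      intro x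
      rw [pow_succ, pow_succ, Module.End.mul_apply, mul_apply_eq_comp, ← ih]
      rfl
  have key : ∀ (p : Polynomial ℂ) (x : H),
      Polynomial.aeval f p (M.mkQ x) = M.mkQ (Polynomial.aeval T p x) := by
    intro p x
    induction p using Polynomial.induction_on' with
    | add p q hp hq => rw [map_add, map_add, LinearMap.add_apply, hp, hq, add_apply, map_add]
    | monomial m c =>
      rw [Polynomial.aeval_monomial, Polynomial.aeval_monomial, Algebra.algebraMap_eq_smul_one,
        Algebra.algebraMap_eq_smul_one, smul_one_mul, smul_one_mul, LinearMap.smul_apply, hpow,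
        smul_apply, map_smul]
  refine ⟨minpoly ℂ f, minpoly.ne_zero (Algebra.IsIntegral.isIntegral f), fun x => ?_⟩
  rw [← Submodule.Quotient.mk_eq_zero, ← Submodule.mkQ_apply, ← key, minpoly.aeval,
    LinearMap.zero_apply]

variable {n : ℕ} {Mz : Fin n → (PolyHardy n →L[ℂ] PolyHardy n)}
  (hMz : ∀ (i : Fin n) (f : PolyHardy n) (k : Fin n → ℕ),
      Mz i f k = if k i = 0 then 0 else f (Function.update k i (k i - 1)))
  (M : Submodule ℂ (PolyHardy n))
  {R : Fin n → (M →L[ℂ] M)} (hR : ∀ i x, (R i x : PolyHardy n) = Mz i x)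

include hR in

theorem coe_pow_restrict (i : Fin n) (m : ℕ) (x : M) :
    ((R i ^ m) x : PolyHardy n) = (Mz i ^ m) x := by
  induction m generalizing x with
  | zero => simp
  | succ m ih => rw [pow_succ, pow_succ, mul_apply_eq_comp, mul_apply_eq_comp, ih, hR]

include hR in
theorem coe_aeval_restrict (i : Fin n) (p : Polynomial ℂ) (x : M) :
    (Polynomial.aeval (R i) p x : PolyHardy n) = Polynomial.aeval (Mz i) p x := by
  induction p using Polynomial.induction_on' with
  | add p q hp hq => rw [map_add, map_add, add_apply, add_apply, Submodule.coe_add, hp, hq]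
  | monomial m c =>
    rw [Polynomial.aeval_monomial, Polynomial.aeval_monomial, Algebra.algebraMap_eq_smul_one,
      Algebra.algebraMap_eq_smul_one, smul_one_mul, smul_one_mul, smul_apply, smul_apply,
      Submodule.coe_smul, coe_pow_restrict M hR]

variable [CompleteSpace M]

include hR in
theorem coe_adjoint_restrict_sub_mem (i : Fin n) (x : M) :
    (adjoint (R i) x : PolyHardy n) - adjoint (Mz i) x ∈ Mᗮ := by
  intro y hy
  have h : inner ℂ (y : PolyHardy n) (adjoint (R i) x : PolyHardy n) =
      inner ℂ (Mz i y) (x : PolyHardy n) := by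
    rw [← hR i ⟨y, hy⟩]
    exact adjoint_inner_right (R i) ⟨y, hy⟩ x
  rw [inner_sub_right, h, adjoint_inner_right, sub_self]

include hMz hR

theorem adjoint_restrict_restrict (i : Fin n) (x : M) : adjoint (R i) (R i x) = x := by
  refine ext_inner_right ℂ fun y => ?_
  rw [adjoint_inner_left, Submodule.coe_inner, hR, hR, ← adjoint_inner_left,
    adjoint_shift_shift hMz]
  rfl

/-- The restricted shifts have no common nontrivial reducing subspace. -/
theorem restrict_irreducible [FiniteDimensional ℂ Mᗮ] (i₀ : Fin n)
    (A : StarSubalgebra ℂ (M →L[ℂ] M)) (hA : ∀ i, R i ∈ A) (u v : M) (hu : u ≠ 0)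
    (huv : ∀ T ∈ A, inner ℂ v (T u) = 0) : v = 0 := by
  by_contra hv
  have hinv : ∀ i, ∀ x ∈ M, Mz i x ∈ M := fun i x hx => by
    rw [← hR i ⟨x, hx⟩]; exact (R i ⟨x, hx⟩).2
  obtain ⟨p, hp0, hp⟩ := exists_aeval_mem M (Mz i₀) (hinv i₀)
  let Tp : PolyHardy n →L[ℂ] M := (Polynomial.aeval (Mz i₀) p).codRestrict M hp
  have hTp : ∀ x : M, Tp x = Polynomial.aeval (R i₀) p x := fun x =>
    Subtype.ext (coe_aeval_restrict M hR i₀ p x).symm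
  have hpA : Polynomial.aeval (R i₀) p ∈ A := by
    have := Polynomial.aeval_mem_adjoin_singleton ℂ (R i₀) (p := p)
    exact Algebra.adjoin_le (S := A.toSubalgebra) (Set.singleton_subset_iff.2 (hA i₀)) this
  let ev : (M →L[ℂ] M) →ₗ[ℂ] M := (ContinuousLinearMap.apply ℂ M u : (M →L[ℂ] M) →L[ℂ] M)
  let N₀ : Submodule ℂ M := A.toSubalgebra.toSubmodule.map ev
  let N := N₀.topologicalClosure
  have hN₀ : ∀ T ∈ A, T u ∈ N := fun T hT => N₀.le_topologicalClosure ⟨T, hT, rfl⟩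
  have hN : ∀ T ∈ A, ∀ x ∈ N, T x ∈ N := by
    intro T hT x hx
    have hc : IsClosed {x | T x ∈ N} := N₀.isClosed_topologicalClosure.preimage T.continuous
    refine hc.closure_subset_iff.2 ?_ hx
    rintro _ ⟨S, hS, rfl⟩
    exact hN₀ (T * S) (mul_mem hT hS)
  have hNo : ∀ T ∈ A, ∀ x ∈ Nᗮ, T x ∈ Nᗮ := by
    intro T hT x hx y hy
    have hT' : adjoint T ∈ A := star_mem hT
    rw [← adjoint_inner_left]
    exact hx _ (hN _ hT' y hy)
  have hvN : v ∈ Nᗮ := by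
    rw [Submodule.orthogonal_closure]
    rintro _ ⟨T, hT, rfl⟩
    exact inner_eq_zero_symm.1 (huv T hT)
  have hcN : CompleteSpace N := N₀.isClosed_topologicalClosure.completeSpace_coe
  let Q : M →L[ℂ] M := N.starProjection
  have hQ : ∀ i x, Q (R i x) = R i (Q x) := by
    intro i x
    refine Submodule.eq_starProjection_of_mem_orthogonal (hN _ (hA i) _
      (Submodule.starProjection_apply_mem _ _)) ?_
    rw [← map_sub]
    exact hNo _ (hA i) _ (Submodule.sub_starProjection_mem_orthogonal _)
  have hcomm : ∀ i f, Tp (Mz i f) = R i (Tp f) := by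
    intro i f
    apply Subtype.ext
    rw [hR]
    apply toPowerSeries_injective
    change toPowerSeries (Polynomial.aeval (Mz i₀) p (Mz i f)) =
      toPowerSeries (Mz i (Polynomial.aeval (Mz i₀) p f))
    rw [toPowerSeries_aeval_shift hMz, toPowerSeries_shift hMz, toPowerSeries_shift hMz,
      toPowerSeries_aeval_shift hMz]
    ring
  have hzero := eq_zero_of_commute hMz (S := M.subtypeL ∘L (Q ∘L Tp)) (y := v)
    (fun i f => by
      change ((Q (Tp (Mz i f)) : M) : PolyHardy n) = Mz i (Q (Tp f) : M)
      rw [hcomm, hQ, hR])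
    (fun h => hv (Subtype.ext h))
    (by
      change ((Q (Tp v) : M) : PolyHardy n) = 0
      rw [hTp, (Submodule.starProjection_apply_eq_zero_iff (K := N)).2 (hNo _ hpA v hvN)]
      rfl) u
  have hu' : ((Q (Tp u) : M) : PolyHardy n) = 0 := hzero
  rw [hTp, Submodule.starProjection_eq_self_iff.2 (hN₀ _ hpA), coe_aeval_restrict M hR] at hu'
  exact hu (Subtype.ext (aeval_shift_injective hMz i₀ hp0 hu'))

theorem finiteRank_commutator [FiniteDimensional ℂ Mᗮ] {i j : Fin n} (hij : i ≠ j) :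
    FiniteRank (adjoint (R i) * R j - R j * adjoint (R i)) := by
  refine .of_forall_coe_mem (Mᗮ ⊔ Mᗮ.map (Mz j : PolyHardy n →ₗ[ℂ] PolyHardy n)) fun x => ?_
  have h1 := coe_adjoint_restrict_sub_mem M hR i (R j x)
  have h2 := coe_adjoint_restrict_sub_mem M hR i x
  have heq : ((adjoint (R i) * R j - R j * adjoint (R i)) x : PolyHardy n) =
      ((adjoint (R i) (R j x) : PolyHardy n) - adjoint (Mz i) (R j x : PolyHardy n)) -
        Mz j ((adjoint (R i) x : PolyHardy n) - adjoint (Mz i) x) := by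
    simp only [sub_apply, mul_apply_eq_comp, Submodule.coe_sub, map_sub, hR,
      adjoint_shift_comm hMz hij]
    abel
  rw [heq]
  exact sub_mem (Submodule.mem_sup_left h1) (Submodule.mem_sup_right ⟨_, h2, rfl⟩)

theorem finiteRank_of_adjoint_restrict_eq_zero [FiniteDimensional ℂ Mᗮ] {T : M →L[ℂ] M}
    (hT : ∀ i x, adjoint (R i) (T x) = 0) : FiniteRank T := by
  have hmem : ∀ i (y : LinearMap.range (T : M →ₗ[ℂ] M)),
      adjoint (Mz i) ((y : M) : PolyHardy n) ∈ Mᗮ := by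
    rintro i ⟨_, x, rfl⟩
    have h := coe_adjoint_restrict_sub_mem M hR i (T x)
    rw [hT, Submodule.coe_zero, zero_sub, neg_mem_iff] at h
    exact h
  let emb : LinearMap.range (T : M →ₗ[ℂ] M) →ₗ[ℂ] PolyHardy n :=
    M.subtype ∘ₗ (LinearMap.range (T : M →ₗ[ℂ] M)).subtype
  let L : LinearMap.range (T : M →ₗ[ℂ] M) →ₗ[ℂ] (Fin n → Mᗮ) × ℂ :=
    (LinearMap.pi fun i =>
      (((adjoint (Mz i) : PolyHardy n →L[ℂ] PolyHardy n) : PolyHardy n →ₗ[ℂ] PolyHardy n) ∘ₗ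
        emb).codRestrict Mᗮ (hmem i)).prod
      (((coordL 0 : PolyHardy n →L[ℂ] ℂ) : PolyHardy n →ₗ[ℂ] ℂ) ∘ₗ emb)
  refine FiniteDimensional.of_injective L ((injective_iff_map_eq_zero L).2 fun y hy => ?_)
  have h1 : ∀ i, adjoint (Mz i) (emb y) = 0 := fun i =>
    congrArg Subtype.val (congrFun (congrArg Prod.fst hy) i)
  have h2 : coordL 0 (emb y) = 0 := congrArg Prod.snd hy
  have hy0 : emb y = 0 := by
    ext k
    by_cases hk : ∃ i, k i ≠ 0
    · obtain ⟨i, hi⟩ := hk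
      have h3 := adjoint_shift_apply hMz i (emb y) (Function.update k i (k i - 1))
      rw [h1] at h3
      simpa [Nat.sub_add_cancel (Nat.pos_of_ne_zero hi)] using h3.symm
    · push Not at hk
      obtain rfl : k = 0 := funext hk
      rw [coordL_apply] at h2
      exact h2
  exact Subtype.ext (Subtype.ext hy0)

theorem exists_finiteRank_ne_zero [FiniteDimensional ℂ Mᗮ] [Nontrivial M]
    (A : StarSubalgebra ℂ (M →L[ℂ] M)) (hA : ∀ i, R i ∈ A) :
    ∃ T ∈ A, T ≠ 0 ∧ FiniteRank T := by
  have hadjA : ∀ i, adjoint (R i) ∈ A := fun i => star_mem (hA i)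
  by_cases hdc : ∃ i j, i ≠ j ∧ adjoint (R i) * R j - R j * adjoint (R i) ≠ 0
  · obtain ⟨i, j, hij, hne⟩ := hdc
    exact ⟨_, sub_mem (mul_mem (hadjA i) (hA j)) (mul_mem (hA j) (hadjA i)), hne,
      finiteRank_commutator hMz M hR hij⟩
  push Not at hdc
  have hcomm : ∀ i j, i ≠ j → Commute (adjoint (R i)) (R j) := fun i j hij =>
    sub_eq_zero.1 (hdc i j hij)
  have hRR : ∀ i j, Commute (R i) (R j) := fun i j => by
    ext1 x
    apply Subtype.ext
    simp only [mul_apply_eq_comp, hR]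
    exact shift_comm hMz i j x
  have hadj : ∀ i j, Commute (adjoint (R i)) (adjoint (R j)) := fun i j =>
    (hRR i j).star_star
  have hisom : ∀ i, adjoint (R i) * R i = 1 := fun i =>
    ContinuousLinearMap.ext (adjoint_restrict_restrict hMz M hR i)
  let E : Fin n → (M →L[ℂ] M) := fun i => 1 - R i * adjoint (R i)
  have hEA : ∀ i, E i ∈ A := fun i => sub_mem (one_mem A) (mul_mem (hA i) (hadjA i))
  have hRE : ∀ i j, i ≠ j → Commute (R i) (E j) := fun i j hij =>
    (Commute.one_right _).sub_right ((hRR i j).mul_right (hcomm j i hij.symm).symm)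
  have hRE' : ∀ i j, i ≠ j → Commute (adjoint (R i)) (E j) := fun i j hij =>
    (Commute.one_right _).sub_right ((hcomm i j hij).mul_right (hadj i j))
  have hRlist : ∀ (l : List (Fin n)) (i), i ∉ l → Commute (R i) (l.map E).prod := by
    intro l i hi
    refine Commute.list_prod_right _ _ fun T hT => ?_
    obtain ⟨j, hj, rfl⟩ := List.mem_map.1 hT
    exact hRE i j (fun h => hi (h ▸ hj))
  have hne : ∀ l : List (Fin n), l.Nodup → (l.map E).prod ≠ 0 := by
    intro l
    induction l with
    | nil => intro _; simp
    | cons j l ih =>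
      intro hl h0
      rw [List.nodup_cons] at hl
      refine ih hl.2 ?_
      set D := (l.map E).prod with hD
      have h1 : D = R j * D * adjoint (R j) := by
        have hc : Commute (adjoint (R j)) D := by
          refine Commute.list_prod_right _ _ fun T hT => ?_
          obtain ⟨k, hk, rfl⟩ := List.mem_map.1 hT
          exact hRE' j k (fun h => hl.1 (h ▸ hk))
        rw [List.map_cons, List.prod_cons, ← hD, sub_mul, one_mul, sub_eq_zero] at h0
        rw [mul_assoc, ← hc.eq, ← mul_assoc, ← h0]
      have h2 : ∀ m : ℕ, D = R j ^ m * D * adjoint (R j) ^ m := by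
        intro m
        induction m with
        | zero => simp
        | succ m ihm =>
          calc D = R j ^ m * D * adjoint (R j) ^ m := ihm
            _ = R j ^ m * (R j * D * adjoint (R j)) * adjoint (R j) ^ m := by rw [← h1]
            _ = _ := by rw [pow_succ, pow_succ']; simp only [mul_assoc]
      ext1 x
      apply Subtype.ext
      ext k
      rw [h2 (k j + 1), mul_assoc, mul_apply_eq_comp, coe_pow_restrict M hR]
      exact shift_pow_apply_eq_zero hMz j _ _ k (Nat.lt_succ_self _)
  have hker : ∀ (l : List (Fin n)), ∀ i ∈ l, adjoint (R i) * (l.map E).prod = 0 := by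
    intro l
    induction l with
    | nil => simp
    | cons j l ih =>
      intro i hi
      rw [List.map_cons, List.prod_cons, ← mul_assoc]
      by_cases hij : i = j
      · subst hij
        rw [mul_sub, mul_one, ← mul_assoc, hisom, one_mul, sub_self, zero_mul]
      · rw [(hRE' i j hij).eq, mul_assoc, ih i ((List.mem_cons.1 hi).resolve_left hij), mul_zero]
  refine ⟨((List.finRange n).map E).prod, list_prod_mem fun T hT => ?_,
    hne _ (List.nodup_finRange n), finiteRank_of_adjoint_restrict_eq_zero hMz M hR fun i x => ?_⟩
  · obtain ⟨i, -, rfl⟩ := List.mem_map.1 hT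
    exact hEA i
  · exact congrArg (fun T => T x) (hker _ i (List.mem_finRange i))

/-- The `C^*`-algebra generated by the shifts on an invariant subspace of finite codimension
contains all finite-rank operators. -/
theorem finiteRank_mem_genCStar_restrict [FiniteDimensional ℂ Mᗮ] (i₀ : Fin n) {T : M →L[ℂ] M}
    (hT : FiniteRank T) : T ∈ genCStar (Set.range R) :=
  finiteRank_mem_genCStar R (restrict_irreducible hMz M hR i₀)
    (fun A _ => exists_finiteRank_ne_zero hMz M hR A) hT

end InvariantSubspace

/-- If `M₁ ⊆ M₂` are invariant subspaces of `H²(𝔻ⁿ)` and `M₁` has finite codimension, then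
`T(M₁) = { P^{M₂}_{M₁} T|_{M₁} : T ∈ T(M₂) }`. -/
theorem stmt15 {n : ℕ} (hn : 2 ≤ n)
    (Mz : Fin n → (PolyHardy n →L[ℂ] PolyHardy n))
    (hMz : ∀ (i : Fin n) (f : PolyHardy n) (k : Fin n → ℕ),
      Mz i f k = if k i = 0 then 0 else f (Function.update k i (k i - 1)))
    (M₁ M₂ : Submodule ℂ (PolyHardy n)) (h12 : M₁ ≤ M₂)
    (hM₁ : IsClosed (M₁ : Set (PolyHardy n))) (hM₂ : IsClosed (M₂ : Set (PolyHardy n)))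
    (hinv₁ : ∀ (i : Fin n), ∀ x ∈ M₁, Mz i x ∈ M₁)
    (hinv₂ : ∀ (i : Fin n), ∀ x ∈ M₂, Mz i x ∈ M₂)
    (hcodim : FiniteDimensional ℂ ↥M₁ᗮ) :
    TalgGen M₁ hM₁ (fun i => restrictS M₁ (Mz i) (hinv₁ i))
      = compressNested M₁ M₂ h12 hM₁ ''
          TalgGen M₂ hM₂ (fun i => restrictS M₂ (Mz i) (hinv₂ i)) := by
  have : CompleteSpace M₁ := hM₁.completeSpace_coe
  have : CompleteSpace M₂ := hM₂.completeSpace_coe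
  have i₀ : Fin n := ⟨0, by omega⟩
  have : FiniteDimensional ℂ M₂ᗮ :=
    Submodule.finiteDimensional_of_le (Submodule.orthogonal_le h12)
  let J : M₁ →L[ℂ] M₂ := M₁.subtypeL.codRestrict M₂ fun x => h12 x.2
  have hJ : adjoint J = M₁.orthogonalProjectionOnto ∘L M₂.subtypeL := by
    symm
    rw [eq_adjoint_iff]
    intro x y
    exact Submodule.inner_orthogonalProjectionOnto_eq_of_mem_right y (x : PolyHardy n)
  have hfin : FiniteRank (1 - J ∘L adjoint J) := by
    refine .of_forall_coe_mem M₁ᗮ fun x => ?_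
    rw [hJ]
    exact Submodule.sub_starProjection_mem_orthogonal (K := M₁) (x : PolyHardy n)
  have hJJ : adjoint J ∘L J = 1 := by
    rw [hJ]
    ext1 x
    exact Submodule.orthogonalProjectionOnto_mem_subspace_eq_self x
  have h := genCStar_eq_image_compression
    (fun i => restrictS M₁ (Mz i) (hinv₁ i)) (fun i => restrictS M₂ (Mz i) (hinv₂ i)) J hJJ hfin
    (fun i => rfl)
    (fun T => finiteRank_mem_genCStar_restrict hMz M₁ (fun _ _ => rfl) i₀)
    (fun T => finiteRank_mem_genCStar_restrict hMz M₂ (fun _ _ => rfl) i₀)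
  rw [hJ] at h
  exact h
end
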